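/- Let ψ : E → [0,∞) be continuous. (Lower bound) If F : P_ψ(E) → ℝ ∪ {∞} is lower semicontinuous for the ψ-weak topology and bounded from below, then liminf_{n→∞} (1/n) ρ_n(n F ∘ L_n) ≥ sup_{ν ∈ P_ψ(E)} (F(ν) − α(ν)). (Upper bound) If in addition the sub-level sets of α are pre-compact subsets of P_ψ(E), and F : P_ψ(E) → ℝ ∪ {−∞} is upper semicontinuous for the ψ-weak topology and bounded from above, then limsup_{n→∞} (1/n) ρ_n(n F ∘ L_n) ≤ sup_{ν ∈ P_ψ(E)} (F(ν) − α(ν)). -/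

import Mathlib

open MeasureTheory ProbabilityTheory Filter Topology Set
open scoped ENNReal NNReal

noncomputable section

namespace SanovDual

attribute [local instance] Classical.propDecidable

/-- The integral of an `EReal`-valued function, with the convention `∞ - ∞ := -∞`. -/
def erealIntegral {X : Type*} [MeasurableSpace X] (μ : Measure X) (f : X → EReal) : EReal :=
  if (∫⁻ x, (if f x = ⊥ then ⊤ else ENNReal.ofReal (-(f x).toReal)) ∂μ) = ⊤ then ⊥
  else ((∫⁻ x, (if f x = ⊤ then ⊤ else ENNReal.ofReal ((f x).toReal)) ∂μ : ℝ≥0∞) : EReal)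
      - ((∫⁻ x, (if f x = ⊥ then ⊤ else ENNReal.ofReal (-(f x).toReal)) ∂μ : ℝ≥0∞) : EReal)

/-- Extension of a function on probability measures to all measures (value `∞` elsewhere). -/
def extend {E : Type*} [MeasurableSpace E] (α : ProbabilityMeasure E → EReal)
    (μ : Measure E) : EReal :=
  if h : IsProbabilityMeasure μ then α ⟨μ, h⟩ else ⊤

/-- The conditional law of the `k`-th coordinate given the first `k` coordinates (`0`-indexed:
given coordinates `0, …, k-1`), under a probability measure on `Fin n → E`. -/
def condLaw {E : Type*} [MeasurableSpace E] [TopologicalSpace E] [PolishSpace E] [BorelSpace E]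
    [Nonempty E] (n : ℕ) (ν : ProbabilityMeasure (Fin n → E)) (k : Fin n) :
    Kernel (Fin (k : ℕ) → E) E :=
  Measure.condKernel ((ν : Measure (Fin n → E)).map
      (fun x => ((fun i : Fin (k : ℕ) => x (Fin.castLE k.isLt.le i)), x k)))

/-- The functional `α_n` on `P(E^n)` built from `α` by summing `α` applied to the successive
conditional laws in the disintegration. -/
def alphan {E : Type*} [MeasurableSpace E] [TopologicalSpace E] [PolishSpace E] [BorelSpace E]
    [Nonempty E] (α : ProbabilityMeasure E → EReal) (n : ℕ)
    (ν : ProbabilityMeasure (Fin n → E)) : EReal :=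
  ∑ k : Fin n, erealIntegral (ν : Measure (Fin n → E))
    (fun x => extend α (condLaw n ν k (fun i => x (Fin.castLE k.isLt.le i))))

/-- The convex conjugate `ρ_n` of `α_n`, acting on (extended-real-valued) functions on `E^n`. -/
def rhon {E : Type*} [MeasurableSpace E] [TopologicalSpace E] [PolishSpace E] [BorelSpace E]
    [Nonempty E] (α : ProbabilityMeasure E → EReal) (n : ℕ) (f : (Fin n → E) → EReal) : EReal :=
  ⨆ ν : ProbabilityMeasure (Fin n → E), erealIntegral (ν : Measure (Fin n → E)) f - alphan α n ν

/-- `ρ = ρ₁` on bounded (real-valued) functions. -/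
def rho {E : Type*} [MeasurableSpace E] (α : ProbabilityMeasure E → EReal) (f : E → ℝ) : EReal :=
  ⨆ ν : ProbabilityMeasure E, ((∫ x, f x ∂(ν : Measure E) : ℝ) : EReal) - α ν

/-- `ρ` on extended-real-valued functions, with the convention `∞ - ∞ := -∞` for integrals. -/
def rhoE {E : Type*} [MeasurableSpace E] (α : ProbabilityMeasure E → EReal) (f : E → EReal) :
    EReal :=
  ⨆ ν : ProbabilityMeasure E, erealIntegral (ν : Measure E) f - α ν

/-- `ρ` on `[0,∞]`-valued functions. -/
def rhoNN {E : Type*} [MeasurableSpace E] (α : ProbabilityMeasure E → EReal) (g : E → ℝ≥0∞) :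
    EReal :=
  ⨆ ν : ProbabilityMeasure E, ((∫⁻ x, g x ∂(ν : Measure E) : ℝ≥0∞) : EReal) - α ν

/-- The empirical measure `L_n(x) = n⁻¹ ∑ δ_{x_i}` as a measure. -/
def empMeasure {E : Type*} [MeasurableSpace E] (n : ℕ) (x : Fin n → E) : Measure E :=
  (n : ℝ≥0∞)⁻¹ • ∑ i : Fin n, Measure.dirac (x i)

/-- The empirical measure `L_n(x)` as a probability measure (junk value for `n = 0`). -/
def empirical {E : Type*} [MeasurableSpace E] [Nonempty E] (n : ℕ) (x : Fin n → E) :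
    ProbabilityMeasure E :=
  if h : IsProbabilityMeasure (empMeasure n x) then ⟨empMeasure n x, h⟩
  else ⟨Measure.dirac (Classical.arbitrary E), inferInstance⟩

/-- `P_ψ(E)`, the probability measures integrating `ψ`. -/
def Pw (E : Type*) [MeasurableSpace E] (ψ : E → ℝ) : Type _ :=
  {ν : ProbabilityMeasure E // ∫⁻ x, ENNReal.ofReal (ψ x) ∂(ν : Measure E) ≠ ⊤}

/-- The underlying probability measure of an element of `P_ψ(E)`. -/
def Pw.toProb {E : Type*} [MeasurableSpace E] {ψ : E → ℝ} (ν : Pw E ψ) :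
    ProbabilityMeasure E :=
  Subtype.val ν

/-- The `ψ`-weak topology on `P_ψ(E)`: the topology generated by the maps `ν ↦ ∫ f dν` over
continuous `f : E → ℝ` with `|f| ≤ 1 + ψ`. -/
instance {E : Type*} [MeasurableSpace E] [TopologicalSpace E] (ψ : E → ℝ) :
    TopologicalSpace (Pw E ψ) :=
  ⨅ (f : E → ℝ) (_ : Continuous f) (_ : ∀ x, |f x| ≤ 1 + ψ x),
    TopologicalSpace.induced (fun ν : Pw E ψ => ∫ x, f x ∂(ν.toProb : Measure E)) inferInstance

/-- Lift a function on `P_ψ(E)` to one on `P(E)` (junk value `⊤` off `P_ψ(E)`). -/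
def liftPw {E : Type*} [MeasurableSpace E] (ψ : E → ℝ) (F : Pw E ψ → EReal)
    (ν : ProbabilityMeasure E) : EReal :=
  if h : ∫⁻ x, ENNReal.ofReal (ψ x) ∂(ν : Measure E) ≠ ⊤ then F ⟨ν, h⟩ else ⊤

/-- The canonical map `EReal → ℝ≥0∞`. -/
def erealToENNReal (x : EReal) : ℝ≥0∞ :=
  if x = ⊤ then ⊤ else ENNReal.ofReal x.toReal

instance {E : Type*} [MeasurableSpace E] : MeasurableSpace (ProbabilityMeasure E) :=
  Subtype.instMeasurableSpace


section Topology

variable {E : Type*} [MeasurableSpace E]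

lemma extend_eq (α : ProbabilityMeasure E → EReal) (μ : Measure E) [h : IsProbabilityMeasure μ] :
    extend α μ = α ⟨μ, h⟩ := dif_pos h

/-- A probability measure integrating `ψ`, as an element of `P_ψ(E)`. -/
def Pw.ofProb {ψ : E → ℝ} (ν : ProbabilityMeasure E)
    (h : ∫⁻ x, ENNReal.ofReal (ψ x) ∂(ν : Measure E) ≠ ⊤) : Pw E ψ := ⟨ν, h⟩

variable [TopologicalSpace E] {ψ : E → ℝ}

/-- The test functions generating the `ψ`-weak topology. -/
def IsTest (ψ f : E → ℝ) : Prop := Continuous f ∧ ∀ x, |f x| ≤ 1 + ψ x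

lemma Pw.continuous_integral {f : E → ℝ} (hf : IsTest ψ f) :
    Continuous fun ν : Pw E ψ => ∫ x, f x ∂(ν.toProb : Measure E) :=
  continuous_iInf_dom (i := f) (continuous_iInf_dom (i := hf.1)
    (continuous_iInf_dom (i := hf.2) continuous_induced_dom))

lemma Pw.exists_finset_of_mem_nhds {μ : Pw E ψ} {U : Set (Pw E ψ)} (hU : U ∈ 𝓝 μ) :
    ∃ s : Finset (E → ℝ), (∀ f ∈ s, IsTest ψ f) ∧ ∃ ε > 0, ∀ μ' : Pw E ψ,
      (∀ f ∈ s, |∫ x, f x ∂(μ'.toProb : Measure E) - ∫ x, f x ∂(μ.toProb : Measure E)| < ε) →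
        μ' ∈ U := by
  rw [nhds_iInf] at hU
  refine Filter.iInf_sets_induct hU ⟨∅, by simp, 1, one_pos, by simp⟩ ?_
  rintro f s₁ s₂ h₁ ⟨s, hs, ε, hε, h⟩
  rw [nhds_iInf] at h₁
  by_cases hf : IsTest ψ f
  · rw [iInf_pos hf.1, nhds_iInf, iInf_pos hf.2] at h₁
    rw [nhds_induced, (Metric.nhds_basis_ball.comap _).mem_iff] at h₁
    obtain ⟨δ, hδ, hsub⟩ := h₁
    refine ⟨insert f s, ?_, min ε δ, lt_min hε hδ, fun μ' hμ' => ⟨hsub ?_, h μ' ?_⟩⟩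
    · simpa using ⟨hf, hs⟩
    · exact (hμ' f (Finset.mem_insert_self _ _)).trans_le (min_le_right _ _)
    · exact fun g hg => (hμ' g (Finset.mem_insert_of_mem hg)).trans_le (min_le_left _ _)
  · refine ⟨s, hs, ε, hε, fun μ' hμ' => ⟨?_, h μ' hμ'⟩⟩
    have : s₁ = univ := by
      by_cases h1 : Continuous f
      · have h2 : ¬ ∀ x, |f x| ≤ 1 + ψ x := fun h2 => hf ⟨h1, h2⟩
        rwa [iInf_pos h1, nhds_iInf, iInf_neg h2, Filter.mem_top] at h₁
      · rwa [iInf_neg h1, Filter.mem_top] at h₁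
    rw [this]; trivial

variable [BorelSpace E]

lemma Pw.integrable_weight (hψc : Continuous ψ) (hψ0 : ∀ x, 0 ≤ ψ x) (ν : Pw E ψ) :
    Integrable ψ (ν.toProb : Measure E) := by
  refine ⟨hψc.measurable.aestronglyMeasurable, ?_⟩
  rw [hasFiniteIntegral_iff_ofReal (ae_of_all _ hψ0)]
  exact lt_top_iff_ne_top.2 ν.2

lemma Pw.integrable (hψc : Continuous ψ) (hψ0 : ∀ x, 0 ≤ ψ x) (ν : Pw E ψ) {f : E → ℝ}
    (hf : IsTest ψ f) : Integrable f (ν.toProb : Measure E) :=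
  ((integrable_const 1).add (ν.integrable_weight hψc hψ0)).mono'
    hf.1.measurable.aestronglyMeasurable (ae_of_all _ hf.2)

lemma Pw.continuous_toProb (hψ0 : ∀ x, 0 ≤ ψ x) :
    Continuous (Pw.toProb : Pw E ψ → ProbabilityMeasure E) := by
  rw [ProbabilityMeasure.continuous_iff_forall_continuous_integral]
  intro f
  have hb : 0 < ‖f‖ + 1 := by positivity
  have ht : IsTest ψ fun x => f x / (‖f‖ + 1) := by
    refine ⟨f.continuous.div_const _, fun x => ?_⟩
    rw [abs_div, abs_of_pos hb]
    have := f.norm_coe_le_norm x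
    rw [Real.norm_eq_abs] at this
    have h1 : |f x| / (‖f‖ + 1) ≤ 1 := (div_le_one hb).2 (by linarith)
    linarith [hψ0 x]
  have := (Pw.continuous_integral ht).mul_const (‖f‖ + 1)
  simpa [integral_div, div_mul_cancel₀ _ hb.ne'] using! this

end Topology

section Measurability

variable {E : Type*} [MeasurableSpace E] [TopologicalSpace E] [PolishSpace E] [BorelSpace E]
  {X : Type*} [MeasurableSpace X]

/-- The value of a Markov kernel, as a bundled probability measure. -/
def kernelProb (κ : Kernel X E) [IsMarkovKernel κ] (x : X) : ProbabilityMeasure E :=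
  ⟨κ x, inferInstance⟩

lemma measurableSet_preimage_kernelProb (κ : Kernel X E) [IsMarkovKernel κ]
    {K : Set (ProbabilityMeasure E)} (hK : IsCompact K) :
    MeasurableSet (kernelProb κ ⁻¹' K) := by
  have hsep : ∀ U, IsOpen U → K ⊆ U →
      ∃ V : Set X, MeasurableSet V ∧ kernelProb κ ⁻¹' K ⊆ V ∧ V ⊆ kernelProb κ ⁻¹' U := by
    intro U hU hKU
    refine hK.induction_on (p := fun S =>
      ∃ V : Set X, MeasurableSet V ∧ kernelProb κ ⁻¹' S ⊆ V ∧ V ⊆ kernelProb κ ⁻¹' U)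
      ⟨∅, by simp⟩ ?_ ?_ ?_
    · rintro S T hST ⟨V, hV, h1, h2⟩
      exact ⟨V, hV, (preimage_mono hST).trans h1, h2⟩
    · rintro S T ⟨V, hV, h1, h2⟩ ⟨W, hW, h3, h4⟩
      exact ⟨V ∪ W, hV.union hW, by rw [preimage_union]; exact union_subset_union h1 h3,
        union_subset h2 h4⟩
    · intro μ hμ
      have hmem : ∀ ν : ProbabilityMeasure E,
          ∫⁻ x, ENNReal.ofReal ((fun _ => 0 : E → ℝ) x) ∂(ν : Measure E) ≠ ⊤ := by simp
      have hnhds : Pw.toProb ⁻¹' U ∈ 𝓝 (Pw.ofProb μ (hmem μ)) :=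
        (hU.preimage (Pw.continuous_toProb fun _ => le_rfl)).mem_nhds (hKU hμ)
      obtain ⟨s, hs, ε, hε, h⟩ := Pw.exists_finset_of_mem_nhds hnhds
      refine ⟨{ν : ProbabilityMeasure E | ∀ f ∈ s, |∫ x, f x ∂(ν : Measure E) -
        ∫ x, f x ∂(μ : Measure E)| < ε}, mem_nhdsWithin_of_mem_nhds ?_,
        kernelProb κ ⁻¹' {ν : ProbabilityMeasure E | ∀ f ∈ s, |∫ x, f x ∂(ν : Measure E) -
        ∫ x, f x ∂(μ : Measure E)| < ε}, ?_, subset_rfl, ?_⟩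
      · refine (Filter.eventually_all_finset s).2 fun f hf => ?_
        have hc : Continuous fun ν : ProbabilityMeasure E => ∫ x, f x ∂(ν : Measure E) :=
          ProbabilityMeasure.continuous_integral_boundedContinuousFunction
            (BoundedContinuousFunction.ofNormedAddCommGroup f (hs f hf).1 1
              (by simpa using (hs f hf).2))
        have : IsOpen {ν : ProbabilityMeasure E |
            |∫ x, f x ∂(ν : Measure E) - ∫ x, f x ∂(μ : Measure E)| < ε} :=
          isOpen_lt (by fun_prop) continuous_const
        exact this.mem_nhds (by simpa using hε)
      · have : kernelProb κ ⁻¹' {ν : ProbabilityMeasure E | ∀ f ∈ s, |∫ x, f x ∂(ν : Measure E) -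
            ∫ x, f x ∂(μ : Measure E)| < ε} =
            ⋂ f ∈ s, {x | |∫ y, f y ∂(κ x) - ∫ y, f y ∂(μ : Measure E)| < ε} := by
          ext x; simp [kernelProb]
        rw [this]
        refine Finset.measurableSet_biInter s fun f hf => ?_
        have hm : Measurable fun x => ∫ y, f y ∂(κ x) :=
          (StronglyMeasurable.integral_kernel
            (hs f hf).1.measurable.stronglyMeasurable).measurable
        exact measurableSet_lt (by fun_prop) measurable_const
      · intro x hx
        exact h (Pw.ofProb (kernelProb κ x) (hmem _)) hx
  obtain ⟨T, hTo, hTc, hT⟩ := hK.isClosed.isGδ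
  have := hTc.to_subtype
  choose V hVm hKV hVU using fun U : T => hsep U (hTo U U.2) (hT ▸ sInter_subset_of_mem U.2)
  have : kernelProb κ ⁻¹' K = ⋂ U, V U := by
    refine Subset.antisymm (subset_iInter hKV) fun x hx => ?_
    rw [mem_preimage, hT, mem_sInter]
    exact fun U hU => hVU ⟨U, hU⟩ (mem_iInter.1 hx ⟨U, hU⟩)
  rw [this]
  exact MeasurableSet.iInter hVm

lemma measurable_extend_kernel (α : ProbabilityMeasure E → EReal) (hbot : ∀ ν, α ν ≠ ⊥)
    (hcompact : ∀ c : ℝ, IsCompact {ν : ProbabilityMeasure E | α ν ≤ (c : EReal)})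
    (κ : Kernel X E) [IsMarkovKernel κ] : Measurable fun x => extend α (κ x) := by
  refine measurable_of_Iic fun c => ?_
  simp only [extend_eq]
  induction c with
  | bot => convert MeasurableSet.empty; ext x; simpa using hbot _
  | top => convert MeasurableSet.univ; ext x; simp
  | coe c => exact measurableSet_preimage_kernelProb κ (hcompact c)

end Measurability

section ERealIntegral

variable {X : Type*} [MeasurableSpace X] {μ : Measure X} {f g : X → EReal}

lemma erealIntegral_def (μ : Measure X) (f : X → EReal) :
    erealIntegral μ f = if ∫⁻ x, (-f x).toENNReal ∂μ = ⊤ then ⊥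
      else ((∫⁻ x, (f x).toENNReal ∂μ : ℝ≥0∞) : EReal)
        - ((∫⁻ x, (-f x).toENNReal ∂μ : ℝ≥0∞) : EReal) := by
  simp only [erealIntegral, EReal.toENNReal, EReal.neg_eq_top_iff]
  congr! <;> simp

lemma erealIntegral_mono (h : ∀ᵐ x ∂μ, f x ≤ g x) : erealIntegral μ f ≤ erealIntegral μ g := by
  have h1 : ∫⁻ x, (f x).toENNReal ∂μ ≤ ∫⁻ x, (g x).toENNReal ∂μ :=
    lintegral_mono_ae (h.mono fun x hx => EReal.toENNReal_le_toENNReal hx)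
  have h2 : ∫⁻ x, (-g x).toENNReal ∂μ ≤ ∫⁻ x, (-f x).toENNReal ∂μ :=
    lintegral_mono_ae (h.mono fun x hx =>
      EReal.toENNReal_le_toENNReal (EReal.neg_le_neg_iff.2 hx))
  simp only [erealIntegral_def]
  by_cases hf : ∫⁻ x, (-f x).toENNReal ∂μ = ⊤
  · simp [hf]
  · rw [if_neg hf, if_neg (ne_top_of_le_ne_top hf h2)]
    exact EReal.sub_le_sub (EReal.coe_ennreal_le_coe_ennreal_iff.2 h1)
      (EReal.coe_ennreal_le_coe_ennreal_iff.2 h2)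

lemma erealIntegral_congr_ae (h : ∀ᵐ x ∂μ, f x = g x) :
    erealIntegral μ f = erealIntegral μ g :=
  le_antisymm (erealIntegral_mono (h.mono fun _ => le_of_eq))
    (erealIntegral_mono (h.mono fun _ => ge_of_eq))

lemma erealIntegral_coe {u : X → ℝ} (hu : Integrable u μ) :
    erealIntegral μ (fun x => (u x : EReal)) = ((∫ x, u x ∂μ : ℝ) : EReal) := by
  have hpos : ∫⁻ x, ENNReal.ofReal (u x) ∂μ ≠ ⊤ := hu.lintegral_lt_top.ne
  have hneg : ∫⁻ x, ENNReal.ofReal (-u x) ∂μ ≠ ⊤ := hu.neg.lintegral_lt_top.ne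
  simp only [erealIntegral_def, ← EReal.coe_neg, EReal.toENNReal_of_ne_top (EReal.coe_ne_top _),
    EReal.toReal_coe]
  rw [if_neg hneg, integral_eq_lintegral_pos_part_sub_lintegral_neg_part hu, EReal.coe_sub,
    ← EReal.coe_ennreal_toReal hpos, ← EReal.coe_ennreal_toReal hneg]

lemma erealIntegral_const [IsProbabilityMeasure μ] (c : ℝ) :
    erealIntegral μ (fun _ => (c : EReal)) = c := by
  simpa using! erealIntegral_coe (μ := μ) (integrable_const c)

lemma integrable_toReal_of_erealIntegral (hf : Measurable f) (htop : erealIntegral μ f ≠ ⊤)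
    (hbot : erealIntegral μ f ≠ ⊥) :
    (∀ᵐ x ∂μ, f x = ((f x).toReal : EReal)) ∧ Integrable (fun x => (f x).toReal) μ := by
  rw [erealIntegral_def] at htop hbot
  have hneg : ∫⁻ x, (-f x).toENNReal ∂μ ≠ ⊤ := fun h => hbot (if_pos h)
  rw [if_neg hneg] at htop
  have hpos : ∫⁻ x, (f x).toENNReal ∂μ ≠ ⊤ := by
    intro h
    rw [h, ← EReal.coe_ennreal_toReal hneg] at htop
    exact htop rfl
  have hm1 : Measurable fun x => (f x).toENNReal := by fun_prop
  have hm2 : Measurable fun x => (-f x).toENNReal := by fun_prop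
  have hfin : ∀ᵐ x ∂μ, f x = ((f x).toReal : EReal) := by
    filter_upwards [ae_lt_top hm1 hpos, ae_lt_top hm2 hneg] with x h1 h2
    refine (EReal.coe_toReal ?_ ?_).symm
    · intro h; simp [h] at h1
    · intro h; simp [h] at h2
  refine ⟨hfin, hf.ereal_toReal.aestronglyMeasurable, ?_⟩
  rw [HasFiniteIntegral]
  refine lt_of_le_of_lt ?_ (ENNReal.add_lt_top.2 ⟨hpos.lt_top, hneg.lt_top⟩)
  rw [← lintegral_add_left hm1]
  refine lintegral_mono_ae (hfin.mono fun x hx => ?_)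
  rw [hx, ← EReal.coe_neg]
  simp only [EReal.toENNReal_of_ne_top (EReal.coe_ne_top _), EReal.toReal_coe]
  rw [← ofReal_norm, Real.norm_eq_abs]
  rcases abs_cases (f x).toReal with h | h <;> rw [h.1] <;> simp

end ERealIntegral

section Empirical

variable {E : Type*} [MeasurableSpace E]

lemma isProbabilityMeasure_empMeasure {n : ℕ} (hn : n ≠ 0) (x : Fin n → E) :
    IsProbabilityMeasure (empMeasure n x) := by
  constructor
  have h : (n : ℝ≥0∞) ≠ 0 := by exact_mod_cast hn
  simp [empMeasure, ENNReal.inv_mul_cancel h (ENNReal.natCast_ne_top n)]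

lemma integral_empMeasure {n : ℕ} (x : Fin n → E) {f : E → ℝ} (hf : Measurable f) :
    ∫ y, f y ∂(empMeasure n x) = (n : ℝ)⁻¹ * ∑ i, f (x i) := by
  rw [empMeasure, integral_smul_measure, integral_finsetSum_measure]
  · simp [integral_dirac' f _ hf.stronglyMeasurable]
  · exact fun i _ => integrable_dirac' hf.stronglyMeasurable (by simp)

variable [Nonempty E]

lemma empirical_coe {n : ℕ} (hn : n ≠ 0) (x : Fin n → E) :
    (empirical n x : Measure E) = empMeasure n x := by
  have h : empirical n x = ⟨empMeasure n x, isProbabilityMeasure_empMeasure hn x⟩ :=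
    dif_pos (isProbabilityMeasure_empMeasure hn x)
  rw [h]
  rfl

lemma lintegral_empirical_ne_top (ψ : E → ℝ) (hψ : Measurable ψ) {n : ℕ} (hn : n ≠ 0)
    (x : Fin n → E) :
    ∫⁻ y, ENNReal.ofReal (ψ y) ∂(empirical n x : Measure E) ≠ ⊤ := by
  rw [empirical_coe hn, empMeasure, lintegral_smul_measure, lintegral_finsetSum_measure]
  refine ENNReal.mul_ne_top (by simpa using hn) (ENNReal.sum_ne_top.2 fun i _ => ?_)
  rw [lintegral_dirac' _ (by fun_prop)]
  exact ENNReal.ofReal_ne_top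

variable [TopologicalSpace E] [BorelSpace E] {ψ : E → ℝ}

/-- The empirical measure as an element of `P_ψ(E)`. -/
def Pw.empirical (hψ : Continuous ψ) {n : ℕ} (hn : n ≠ 0) (x : Fin n → E) : Pw E ψ :=
  Pw.ofProb (SanovDual.empirical n x) (lintegral_empirical_ne_top ψ hψ.measurable hn x)

lemma liftPw_empirical (hψ : Continuous ψ) {n : ℕ} (hn : n ≠ 0) (F : Pw E ψ → EReal)
    (x : Fin n → E) : liftPw ψ F (empirical n x) = F (Pw.empirical hψ hn x) :=
  dif_pos (lintegral_empirical_ne_top ψ hψ.measurable hn x)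

lemma Pw.integral_empirical (hψ : Continuous ψ) {n : ℕ} (hn : n ≠ 0) (x : Fin n → E)
    {f : E → ℝ} (hf : Measurable f) :
    ∫ y, f y ∂((Pw.empirical hψ hn x).toProb : Measure E) = (n : ℝ)⁻¹ * ∑ i, f (x i) := by
  rw [← integral_empMeasure x hf, ← empirical_coe hn]
  rfl

end Empirical

section Product

variable {E : Type*} [MeasurableSpace E]

lemma measurable_fin_restrict (n : ℕ) : Measurable fun (ω : ℕ → E) (i : Fin n) => ω i :=
  measurable_pi_lambda _ fun i => measurable_pi_apply (i : ℕ)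

/-- The law of the first `n` coordinates of an i.i.d. sequence. -/
def iidLaw (ν : ProbabilityMeasure E) (n : ℕ) : ProbabilityMeasure (Fin n → E) :=
  ⟨(Measure.infinitePi fun _ : ℕ => (ν : Measure E)).map fun ω (i : Fin n) => ω i,
    Measure.isProbabilityMeasure_map (measurable_fin_restrict n).aemeasurable⟩

lemma map_iidLaw_prodMk (ν : ProbabilityMeasure E) {n : ℕ} (k : Fin n) :
    (iidLaw ν n : Measure (Fin n → E)).map
      (fun x => ((fun i : Fin (k : ℕ) => x (Fin.castLE k.isLt.le i)), x k)) =
    ((iidLaw ν n : Measure (Fin n → E)).map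
      (fun x (i : Fin (k : ℕ)) => x (Fin.castLE k.isLt.le i))).prod (ν : Measure E) := by
  set P := Measure.infinitePi fun _ : ℕ => (ν : Measure E)
  have hind : iIndepFun (fun (i : ℕ) (ω : ℕ → E) => ω i) P :=
    iIndepFun_infinitePi (X := fun _ x => x) (fun _ => measurable_id)
  have h1 := hind.indepFun_finset (Finset.range k) {(k : ℕ)} (by simp) (fun i => by fun_prop)
  have h2 : IndepFun (fun (ω : ℕ → E) (i : Fin (k : ℕ)) => ω i) (fun ω => ω (k : ℕ)) P :=
    h1.comp (φ := fun (y : Finset.range (k : ℕ) → E) (i : Fin (k : ℕ)) => y ⟨i, by simp⟩)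
      (ψ := fun (y : ({(k : ℕ)} : Finset ℕ) → E) => y ⟨k, by simp⟩) (by fun_prop) (by fun_prop)
  have h3 := h2.map_prod_eq_prod_map_map
    (measurable_fin_restrict (k : ℕ)).aemeasurable (measurable_pi_apply (k : ℕ)).aemeasurable
  rw [Measure.infinitePi_map_eval] at h3
  simp only [iidLaw, ProbabilityMeasure.coe_mk]
  rw [Measure.map_map (by fun_prop) (measurable_fin_restrict n),
    Measure.map_map (by fun_prop) (measurable_fin_restrict n)]
  exact h3

variable [TopologicalSpace E] [PolishSpace E] [BorelSpace E] [Nonempty E]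

lemma condLaw_iidLaw (ν : ProbabilityMeasure E) {n : ℕ} (k : Fin n) :
    ∀ᵐ x ∂(iidLaw ν n : Measure (Fin n → E)),
      condLaw n (iidLaw ν n) k (fun i => x (Fin.castLE k.isLt.le i)) = (ν : Measure E) := by
  have hm : Measurable fun (x : Fin n → E) (i : Fin (k : ℕ)) => x (Fin.castLE k.isLt.le i) := by
    fun_prop
  have : IsProbabilityMeasure ((iidLaw ν n : Measure (Fin n → E)).map
      (fun x (i : Fin (k : ℕ)) => x (Fin.castLE k.isLt.le i))) :=
    Measure.isProbabilityMeasure_map hm.aemeasurable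
  have hmap := map_iidLaw_prodMk ν k
  have h := eq_condKernel_of_measure_eq_compProd
    (ρ := (iidLaw ν n : Measure (Fin n → E)).map
      (fun x => ((fun i : Fin (k : ℕ) => x (Fin.castLE k.isLt.le i)), x k)))
    (Kernel.const _ (ν : Measure E)) (by rw [hmap, Measure.fst_prod, Measure.compProd_const])
  have hfst : ((iidLaw ν n : Measure (Fin n → E)).map
      (fun x => ((fun i : Fin (k : ℕ) => x (Fin.castLE k.isLt.le i)), x k))).fst =
      (iidLaw ν n : Measure (Fin n → E)).map
        (fun x (i : Fin (k : ℕ)) => x (Fin.castLE k.isLt.le i)) := by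
    rw [hmap, Measure.fst_prod]
  rw [hfst] at h
  filter_upwards [ae_of_ae_map hm.aemeasurable h] with x hx
  rw [condLaw, ← hx, Kernel.const_apply]

lemma alphan_iidLaw (α : ProbabilityMeasure E → EReal) {ν : ProbabilityMeasure E} {a : ℝ}
    (ha : α ν = a) (n : ℕ) : alphan α n (iidLaw ν n) = ((n * a : ℝ) : EReal) := by
  have : ∀ k : Fin n, erealIntegral (iidLaw ν n : Measure (Fin n → E))
      (fun x => extend α (condLaw n (iidLaw ν n) k (fun i => x (Fin.castLE k.isLt.le i)))) = a := by
    intro k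
    rw [← erealIntegral_const (μ := (iidLaw ν n : Measure (Fin n → E))) a]
    refine erealIntegral_congr_ae ?_
    filter_upwards [condLaw_iidLaw ν k] with x hx
    rw [hx, extend_eq, ← ha]
    rfl
  rw [alphan, Finset.sum_congr rfl fun k _ => this k]
  simp [EReal.coe_mul]

end Product

section LowerBound

variable {E : Type*} [MeasurableSpace E]

lemma tendsto_average_infinitePi (ν : ProbabilityMeasure E) {f : E → ℝ} (hf : Measurable f)
    (hint : Integrable f (ν : Measure E)) :
    ∀ᵐ ω ∂(Measure.infinitePi fun _ : ℕ => (ν : Measure E)),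
      Tendsto (fun n : ℕ => (n : ℝ)⁻¹ * ∑ i : Fin n, f (ω i)) atTop
        (𝓝 (∫ x, f x ∂(ν : Measure E))) := by
  set P := Measure.infinitePi fun _ : ℕ => (ν : Measure E)
  have hmp : ∀ i : ℕ, MeasurePreserving (fun ω : ℕ → E => ω i) P (ν : Measure E) := fun i =>
    ⟨by fun_prop, Measure.infinitePi_map_eval _ i⟩
  have hind : iIndepFun (fun (i : ℕ) (ω : ℕ → E) => f (ω i)) P :=
    iIndepFun_infinitePi (X := fun _ => f) (fun _ => hf)
  have h := strong_law_ae_real (μ := P) (fun (i : ℕ) (ω : ℕ → E) => f (ω i))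
    ((hmp 0).integrable_comp_of_integrable hint) (fun i j hij => hind.indepFun hij)
    (fun i => IdentDistrib.comp ⟨(hmp i).measurable.aemeasurable,
      (hmp 0).measurable.aemeasurable, (hmp i).map_eq.trans (hmp 0).map_eq.symm⟩ hf)
  have h0 : ∫ ω, f (ω 0) ∂P = ∫ x, f x ∂(ν : Measure E) := by
    rw [← (hmp 0).map_eq, integral_map (hmp 0).measurable.aemeasurable hf.aestronglyMeasurable]
  rw [h0] at h
  filter_upwards [h] with ω hω
  refine hω.congr fun n => ?_
  rw [div_eq_inv_mul, Fin.sum_univ_eq_sum_range (fun i => f (ω i))]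

variable [TopologicalSpace E] [PolishSpace E] [BorelSpace E] [Nonempty E] {ψ : E → ℝ}

lemma coe_sub_le_liminf_rhon (α : ProbabilityMeasure E → EReal) (hψc : Continuous ψ)
    (hψ0 : ∀ x, 0 ≤ ψ x) {F : Pw E ψ → EReal} (hF : LowerSemicontinuous F) {C : ℝ}
    (hC : ∀ ν, (C : EReal) ≤ F ν) (ν : Pw E ψ) {a c : ℝ} (ha : α ν.toProb = a)
    (hc : (c : EReal) < F ν) :
    ((c - a : ℝ) : EReal) ≤ Filter.liminf (fun n : ℕ => (((n : ℝ)⁻¹ : ℝ) : EReal) *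
      rhon α n fun x => ((n : ℝ) : EReal) * liftPw ψ F (empirical n x)) Filter.atTop := by
  obtain ⟨s, hs, ε, hε, hU⟩ := Pw.exists_finset_of_mem_nhds (hF ν c hc)
  set P := Measure.infinitePi fun _ : ℕ => (ν.toProb : Measure E)
  let good (n : ℕ) : Set (Fin n → E) := {x | ∀ f ∈ s,
    |(n : ℝ)⁻¹ * ∑ i, f (x i) - ∫ y, f y ∂(ν.toProb : Measure E)| < ε}
  let u (n : ℕ) (x : Fin n → E) : ℝ := if x ∈ good n then c else C
  have hgood : ∀ n, MeasurableSet (good n) := by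
    intro n
    have : good n = ⋂ f ∈ s, {x : Fin n → E |
        |(n : ℝ)⁻¹ * ∑ i, f (x i) - ∫ y, f y ∂(ν.toProb : Measure E)| < ε} := by
      ext x; simp [good]
    rw [this]
    refine Finset.measurableSet_biInter s fun f hf => ?_
    have := (hs f hf).1.measurable
    exact measurableSet_lt (by fun_prop) measurable_const
  have hu : ∀ n, Measurable (u n) := fun n =>
    Measurable.ite (hgood n) measurable_const measurable_const
  have hub : ∀ n x, ‖u n x‖ ≤ |c| + |C| := by
    intro n x
    simp only [u, Real.norm_eq_abs]
    split_ifs <;> linarith [abs_nonneg c, abs_nonneg C]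
  have hui : ∀ n, Integrable (u n) (iidLaw ν.toProb n : Measure (Fin n → E)) := fun n =>
    Integrable.of_bound (hu n).aestronglyMeasurable _ (ae_of_all _ (hub n))
  have hlim : Tendsto (fun n => ∫ x, u n x ∂(iidLaw ν.toProb n : Measure (Fin n → E))) atTop
      (𝓝 c) := by
    have h1 : ∀ n, ∫ x, u n x ∂(iidLaw ν.toProb n : Measure (Fin n → E)) =
        ∫ ω, u n (fun i => ω i) ∂P := fun n =>
      integral_map (measurable_fin_restrict n).aemeasurable (hu n).aestronglyMeasurable
    simp only [h1]
    have h2 : ∫ _, c ∂P = c := by simp [P]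
    rw [← h2]
    refine tendsto_integral_of_dominated_convergence (fun _ => |c| + |C|)
      (fun n => ((hu n).comp (measurable_fin_restrict n)).aestronglyMeasurable) (integrable_const _)
      (fun n => ae_of_all _ fun ω => hub n _) ?_
    have h3 : ∀ᵐ ω ∂P, ∀ f ∈ s, Tendsto (fun n : ℕ => (n : ℝ)⁻¹ * ∑ i : Fin n, f (ω i)) atTop
        (𝓝 (∫ x, f x ∂(ν.toProb : Measure E))) :=
      (ae_ball_iff s.countable_toSet).2 fun f hf =>
        tendsto_average_infinitePi ν.toProb (hs f hf).1.measurable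
          (ν.integrable hψc hψ0 (hs f hf))
    filter_upwards [h3] with ω hω
    refine tendsto_const_nhds.congr' ?_
    have h4 : ∀ᶠ n : ℕ in atTop, ∀ f ∈ s, |(n : ℝ)⁻¹ * ∑ i : Fin n, f (ω i) -
        ∫ x, f x ∂(ν.toProb : Measure E)| < ε :=
      (Filter.eventually_all_finset s).2 fun f hf => (Metric.tendsto_nhds.1 (hω f hf)) ε hε
    filter_upwards [h4] with n hn
    exact (if_pos hn).symm
  have hlim' : Tendsto (fun n => (((∫ x, u n x ∂(iidLaw ν.toProb n : Measure (Fin n → E))) - a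
      : ℝ) : EReal)) atTop (𝓝 ((c - a : ℝ) : EReal)) :=
    (continuous_coe_real_ereal.tendsto _).comp (hlim.sub_const a)
  rw [← hlim'.liminf_eq]
  refine Filter.liminf_le_liminf ?_
  filter_upwards [eventually_ne_atTop 0] with n hn
  have hn' : (0 : ℝ) < n := by positivity
  have h5 : ((n * ((∫ x, u n x ∂(iidLaw ν.toProb n : Measure (Fin n → E))) - a) : ℝ) : EReal) ≤
      rhon α n fun x => ((n : ℝ) : EReal) * liftPw ψ F (empirical n x) := by
    refine le_trans ?_ (le_iSup _ (iidLaw ν.toProb n))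
    rw [alphan_iidLaw α ha, mul_sub, EReal.coe_sub, ← integral_const_mul,
      ← erealIntegral_coe ((hui n).const_mul _)]
    refine EReal.sub_le_sub (erealIntegral_mono (ae_of_all _ fun x => ?_)) le_rfl
    rw [liftPw_empirical hψc hn, EReal.coe_mul]
    refine mul_le_mul_of_nonneg_left ?_ (by exact_mod_cast hn'.le)
    by_cases hx : x ∈ good n
    · simp only [u, if_pos hx]
      refine (hU _ fun f hf => ?_).le
      rw [Pw.integral_empirical hψc hn x (hs f hf).1.measurable]
      exact hx f hf
    · simp only [u, if_neg hx]
      exact hC _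
  calc _ = (((n : ℝ)⁻¹ : ℝ) : EReal) *
        ((n * ((∫ x, u n x ∂(iidLaw ν.toProb n : Measure (Fin n → E))) - a) : ℝ) : EReal) := by
        rw [← EReal.coe_mul, inv_mul_cancel_left₀ hn'.ne']
    _ ≤ _ := mul_le_mul_of_nonneg_left h5 (by exact_mod_cast (inv_pos.2 hn').le)

lemma iSup_sub_le_liminf_rhon (α : ProbabilityMeasure E → EReal) (hbot : ∀ ν, α ν ≠ ⊥)
    (hψc : Continuous ψ) (hψ0 : ∀ x, 0 ≤ ψ x) {F : Pw E ψ → EReal} (hF : LowerSemicontinuous F)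
    {C : ℝ} (hC : ∀ ν, (C : EReal) ≤ F ν) :
    (⨆ ν : Pw E ψ, F ν - α ν.toProb) ≤
      Filter.liminf (fun n : ℕ => (((n : ℝ)⁻¹ : ℝ) : EReal) *
        rhon α n fun x => ((n : ℝ) : EReal) * liftPw ψ F (empirical n x)) Filter.atTop := by
  refine iSup_le fun ν => ?_
  by_cases htop : α ν.toProb = ⊤
  · simp [htop]
  obtain ⟨a, ha⟩ : ∃ a : ℝ, α ν.toProb = a :=
    ⟨_, (EReal.coe_toReal htop (hbot _)).symm⟩
  rw [ha, EReal.sub_le_iff_le_add (by simp) (by simp)]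
  refine EReal.ge_of_forall_gt_iff_ge.1 fun c hc => ?_
  rw [← EReal.sub_le_iff_le_add (by simp) (by simp), ← EReal.coe_sub]
  exact coe_sub_le_liminf_rhon α hψc hψ0 hF hC ν ha hc

end LowerBound

section Excess

variable {E : Type*} {ψ : E → ℝ}

/-- The excess of the weight `1 + ψ` over the level `R`. -/
def excess (ψ : E → ℝ) (R : ℕ) (x : E) : ℝ := max (1 + ψ x - R) 0

lemma excess_nonneg (R : ℕ) (x : E) : 0 ≤ excess ψ R x := le_max_right _ _

variable [TopologicalSpace E]

lemma isTest_excess (hψc : Continuous ψ) (hψ0 : ∀ x, 0 ≤ ψ x) (R : ℕ) :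
    IsTest ψ (excess ψ R) := by
  refine ⟨by unfold excess; fun_prop, fun x => ?_⟩
  have : (0 : ℝ) ≤ R := by positivity
  rw [excess, abs_of_nonneg (le_max_right _ _)]
  exact max_le (by linarith) (by linarith [hψ0 x])

variable [MeasurableSpace E] [BorelSpace E]

lemma exists_integral_excess_le (hψc : Continuous ψ) (hψ0 : ∀ x, 0 ≤ ψ x) {K : Set (Pw E ψ)}
    (hK : IsCompact K) {η : ℝ} (hη : 0 < η) :
    ∃ R : ℕ, ∀ μ ∈ K, ∫ x, excess ψ R x ∂(μ.toProb : Measure E) ≤ η := by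
  have hanti : ∀ {R S : ℕ} (_ : R ≤ S) (μ : Pw E ψ), ∫ x, excess ψ S x ∂(μ.toProb : Measure E) ≤
      ∫ x, excess ψ R x ∂(μ.toProb : Measure E) := by
    intro R S hRS μ
    refine integral_mono (μ.integrable hψc hψ0 (isTest_excess hψc hψ0 S))
      (μ.integrable hψc hψ0 (isTest_excess hψc hψ0 R)) fun x => ?_
    have : (R : ℝ) ≤ S := by exact_mod_cast hRS
    exact max_le_max (by linarith) le_rfl
  refine hK.induction_on (p := fun S => ∃ R : ℕ, ∀ μ ∈ S,
    ∫ x, excess ψ R x ∂(μ.toProb : Measure E) ≤ η) ⟨0, by simp⟩ ?_ ?_ ?_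
  · rintro S T hST ⟨R, hR⟩
    exact ⟨R, fun μ hμ => hR μ (hST hμ)⟩
  · rintro S T ⟨R, hR⟩ ⟨R', hR'⟩
    refine ⟨max R R', ?_⟩
    rintro μ (hμ | hμ)
    · exact (hanti (le_max_left _ _) μ).trans (hR μ hμ)
    · exact (hanti (le_max_right _ _) μ).trans (hR' μ hμ)
  · intro μ _
    have hlim : Tendsto (fun R : ℕ => ∫ x, excess ψ R x ∂(μ.toProb : Measure E)) atTop
        (𝓝 (∫ _, 0 ∂(μ.toProb : Measure E))) := by
      refine tendsto_integral_of_dominated_convergence (fun x => 1 + ψ x)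
        (fun R => (isTest_excess hψc hψ0 R).1.measurable.aestronglyMeasurable)
        ((integrable_const 1).add (μ.integrable_weight hψc hψ0))
        (fun R => ae_of_all _ (isTest_excess hψc hψ0 R).2) (ae_of_all _ fun x => ?_)
      obtain ⟨N, hN⟩ := exists_nat_ge (1 + ψ x)
      refine tendsto_const_nhds.congr' ?_
      filter_upwards [eventually_ge_atTop N] with R hR
      have : (N : ℝ) ≤ R := by exact_mod_cast hR
      exact (max_eq_right (by linarith)).symm
    rw [integral_zero] at hlim
    obtain ⟨R, hR⟩ := (hlim.eventually (gt_mem_nhds hη)).exists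
    have hopen : IsOpen {μ' : Pw E ψ | ∫ x, excess ψ R x ∂(μ'.toProb : Measure E) < η} :=
      isOpen_lt (Pw.continuous_integral (isTest_excess hψc hψ0 R)) continuous_const
    exact ⟨_, mem_nhdsWithin_of_mem_nhds (hopen.mem_nhds hR), R, fun μ' hμ' => le_of_lt hμ'⟩

end Excess

section Penalty

variable {E : Type*} [MeasurableSpace E] {α : ProbabilityMeasure E → EReal}

lemma isProbabilityMeasure_mix (μ₁ μ₂ : ProbabilityMeasure E) {t : ℝ≥0} (ht : t ≤ 1) :
    IsProbabilityMeasure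
      ((t : ℝ≥0∞) • (μ₁ : Measure E) + ((1 - t : ℝ≥0) : ℝ≥0∞) • (μ₂ : Measure E)) := by
  constructor
  simp only [Measure.add_apply, Measure.smul_apply, measure_univ, smul_eq_mul, mul_one]
  rw [← ENNReal.coe_add, add_tsub_cancel_of_le ht, ENNReal.coe_one]

lemma extend_mix_le
    (hconvex : ∀ (μ₁ μ₂ : ProbabilityMeasure E) (t : ℝ≥0), t ≤ 1 →
      extend α ((t : ℝ≥0∞) • (μ₁ : Measure E) + ((1 - t : ℝ≥0) : ℝ≥0∞) • (μ₂ : Measure E))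
        ≤ ((t : ℝ) : EReal) * α μ₁ + (((1 - t : ℝ≥0) : ℝ) : EReal) * α μ₂)
    {μ₁ μ₂ : ProbabilityMeasure E} {t : ℝ≥0} (ht : t ≤ 1) {a₁ a₂ : ℝ} (h₁ : α μ₁ ≤ a₁)
    (h₂ : α μ₂ ≤ a₂) :
    extend α ((t : ℝ≥0∞) • (μ₁ : Measure E) + ((1 - t : ℝ≥0) : ℝ≥0∞) • (μ₂ : Measure E)) ≤
      ((t * a₁ + (1 - t) * a₂ : ℝ) : EReal) := by
  refine (hconvex μ₁ μ₂ t ht).trans ?_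
  have : (1 - t : ℝ) = ((1 - t : ℝ≥0) : ℝ) := by push_cast [NNReal.coe_sub ht]; rfl
  rw [this, EReal.coe_add, EReal.coe_mul, EReal.coe_mul]
  exact add_le_add (mul_le_mul_of_nonneg_left h₁ (by exact_mod_cast t.2))
    (mul_le_mul_of_nonneg_left h₂ (by exact_mod_cast (1 - t).2))

lemma extend_average_le
    (hconvex : ∀ (μ₁ μ₂ : ProbabilityMeasure E) (t : ℝ≥0), t ≤ 1 →
      extend α ((t : ℝ≥0∞) • (μ₁ : Measure E) + ((1 - t : ℝ≥0) : ℝ≥0∞) • (μ₂ : Measure E))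
        ≤ ((t : ℝ) : EReal) * α μ₁ + (((1 - t : ℝ≥0) : ℝ) : EReal) * α μ₂)
    {n : ℕ} (hn : n ≠ 0) {μ : Fin n → ProbabilityMeasure E} {a : Fin n → ℝ}
    (h : ∀ i, α (μ i) ≤ a i) :
    ∃ m : ProbabilityMeasure E, (m : Measure E) = (n : ℝ≥0∞)⁻¹ • ∑ i, (μ i : Measure E) ∧
      α m ≤ (((n : ℝ)⁻¹ * ∑ i, a i : ℝ) : EReal) := by
  induction n with
  | zero => exact absurd rfl hn
  | succ n ih =>
    rcases eq_or_ne n 0 with rfl | hn'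
    · exact ⟨μ 0, by simp, by simpa using h 0⟩
    obtain ⟨m, hm, hαm⟩ := ih hn' (μ := fun i => μ i.castSucc) (a := fun i => a i.castSucc)
      fun i => h _
    have hpos : (0 : ℝ) < n + 1 := by positivity
    have hn0 : (n : ℝ) ≠ 0 := by exact_mod_cast hn'
    let t : ℝ≥0 := n / (n + 1)
    have ht : t ≤ 1 := div_le_one_of_le₀ (by simp) (by simp)
    have ht' : (1 - t : ℝ≥0) = ((n : ℝ≥0) + 1)⁻¹ := by
      rw [← NNReal.coe_inj, NNReal.coe_sub ht]
      simp only [t]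
      push_cast
      field_simp
      ring
    have hprob := isProbabilityMeasure_mix m (μ (Fin.last n)) ht
    have hle := extend_mix_le hconvex ht hαm (h (Fin.last n))
    rw [extend_eq] at hle
    refine ⟨_, ?_, hle.trans (EReal.coe_le_coe_iff.2 (le_of_eq ?_))⟩
    · rw [ProbabilityMeasure.coe_mk, hm, Fin.sum_univ_castSucc, smul_add, smul_smul, ht']
      congr 2
      · simp only [t]
        rw [ENNReal.coe_div (by positivity), ENNReal.div_eq_inv_mul, mul_assoc]
        push_cast
        rw [ENNReal.mul_inv_cancel (by simpa using hn') (ENNReal.natCast_ne_top n), mul_one]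
      · rw [ENNReal.coe_inv (by positivity)]
        push_cast
        rfl
    · rw [Fin.sum_univ_castSucc]
      simp only [t]
      push_cast
      field_simp
      ring

variable [TopologicalSpace E] [BorelSpace E] {ψ : E → ℝ}

lemma exists_lintegral_excess_le (hproper : ∃ ν, α ν ≠ ⊤) (hbot : ∀ ν, α ν ≠ ⊥)
    (hconvex : ∀ (μ₁ μ₂ : ProbabilityMeasure E) (t : ℝ≥0), t ≤ 1 →
      extend α ((t : ℝ≥0∞) • (μ₁ : Measure E) + ((1 - t : ℝ≥0) : ℝ≥0∞) • (μ₂ : Measure E))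
        ≤ ((t : ℝ) : EReal) * α μ₁ + (((1 - t : ℝ≥0) : ℝ) : EReal) * α μ₂)
    (hψc : Continuous ψ) (hψ0 : ∀ x, 0 ≤ ψ x)
    (hfin : ∀ (c : ℝ) (ν : ProbabilityMeasure E), α ν ≤ (c : EReal) →
      ∫⁻ x, ENNReal.ofReal (ψ x) ∂(ν : Measure E) ≠ ⊤)
    (hK : ∀ c : ℝ, IsCompact {ν : Pw E ψ | α ν.toProb ≤ (c : EReal)}) {b : ℝ}
    (hb : ∀ ν, (b : EReal) ≤ α ν) {η : ℝ} (hη : 0 < η) :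
    ∃ R : ℕ, ∀ (μ : ProbabilityMeasure E) (a : ℝ), α μ = a →
      ∫⁻ x, ENNReal.ofReal (excess ψ R x) ∂(μ : Measure E) ≤ ENNReal.ofReal (η * (a - b + 1)) := by
  obtain ⟨ν₀, h₀⟩ := hproper
  obtain ⟨a₀, ha₀⟩ : ∃ a₀ : ℝ, α ν₀ = a₀ := ⟨_, (EReal.coe_toReal h₀ (hbot _)).symm⟩
  obtain ⟨R, hR⟩ := exists_integral_excess_le hψc hψ0 (hK (1 + |b| + |a₀|)) hη
  refine ⟨R, fun μ a ha => ?_⟩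
  have hba : b ≤ a := by rw [← EReal.coe_le_coe_iff, ← ha]; exact hb μ
  have hs : 0 < a - b + 1 := by linarith
  let t : ℝ≥0 := ⟨(a - b + 1)⁻¹, (inv_pos.2 hs).le⟩
  have htr : (t : ℝ) = (a - b + 1)⁻¹ := rfl
  have ht0 : 0 < (t : ℝ) := inv_pos.2 hs
  have ht1' : (t : ℝ) ≤ 1 := inv_le_one_of_one_le₀ (by linarith)
  have ht1 : t ≤ 1 := by exact_mod_cast ht1'
  have htm : (t : ℝ) * (a - b + 1) = 1 := inv_mul_cancel₀ hs.ne'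
  have hprob := isProbabilityMeasure_mix μ ν₀ ht1
  have hle := extend_mix_le hconvex ht1 ha.le ha₀.le
  rw [extend_eq] at hle
  have hle' : α ⟨_, hprob⟩ ≤ ((1 + |b| + |a₀| : ℝ) : EReal) := by
    refine hle.trans (EReal.coe_le_coe_iff.2 ?_)
    have h1 : (t : ℝ) * b ≤ |b| := (mul_le_mul_of_nonneg_left (le_abs_self b) ht0.le).trans
      (mul_le_of_le_one_left (abs_nonneg _) ht1')
    have h2 : (1 - (t : ℝ)) * a₀ ≤ |a₀| :=
      (mul_le_mul_of_nonneg_left (le_abs_self a₀) (by linarith)).trans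
        (mul_le_of_le_one_left (abs_nonneg _) (by linarith))
    nlinarith
  let m : Pw E ψ := Pw.ofProb ⟨_, hprob⟩ (hfin _ _ hle')
  have hm := hR m hle'
  have hint := m.integrable hψc hψ0 (isTest_excess hψc hψ0 R)
  have hl : ∫⁻ x, ENNReal.ofReal (excess ψ R x) ∂(m.toProb : Measure E) ≤ ENNReal.ofReal η := by
    rw [← ofReal_integral_eq_lintegral_ofReal hint (ae_of_all _ fun x => excess_nonneg R x)]
    exact ENNReal.ofReal_le_ofReal hm
  have hl2 : (t : ℝ≥0∞) * ∫⁻ x, ENNReal.ofReal (excess ψ R x) ∂(μ : Measure E) ≤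
      ENNReal.ofReal η := by
    refine le_trans ?_ hl
    change _ ≤ ∫⁻ x, ENNReal.ofReal (excess ψ R x)
      ∂((t : ℝ≥0∞) • (μ : Measure E) + ((1 - t : ℝ≥0) : ℝ≥0∞) • (ν₀ : Measure E))
    rw [lintegral_add_measure, lintegral_smul_measure]
    exact le_self_add
  have htne : (t : ℝ≥0∞) ≠ 0 := by
    rw [Ne, ENNReal.coe_eq_zero, ← NNReal.coe_eq_zero]; exact ht0.ne'
  rw [← ENNReal.mul_le_mul_iff_right htne ENNReal.coe_ne_top]
  refine hl2.trans (le_of_eq ?_)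
  rw [← ENNReal.ofReal_coe_nnreal, ← ENNReal.ofReal_mul ht0.le]
  congr 1
  linear_combination (-η) * htm

variable [PolishSpace E]

lemma lowerSemicontinuous_of_isCompact (hbot : ∀ ν, α ν ≠ ⊥)
    (hcompact : ∀ c : ℝ, IsCompact {ν : ProbabilityMeasure E | α ν ≤ (c : EReal)}) :
    LowerSemicontinuous α := by
  rw [lowerSemicontinuous_iff_isClosed_preimage]
  intro c
  induction c with
  | bot => convert isClosed_empty; ext x; simpa using hbot _
  | top => convert isClosed_univ; ext x; simp
  | coe c => exact (hcompact c).isClosed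

lemma exists_real_le (hbot : ∀ ν, α ν ≠ ⊥)
    (hcompact : ∀ c : ℝ, IsCompact {ν : ProbabilityMeasure E | α ν ≤ (c : EReal)}) :
    ∃ b : ℝ, ∀ ν, (b : EReal) ≤ α ν := by
  by_cases hproper : ∀ ν, α ν = ⊤
  · exact ⟨0, fun ν => by simp [hproper]⟩
  push Not at hproper
  obtain ⟨ν₀, h₀⟩ := hproper
  have ha : α ν₀ = ((α ν₀).toReal : EReal) := (EReal.coe_toReal h₀ (hbot _)).symm
  obtain ⟨ν₁, h₁, hmin⟩ := LowerSemicontinuousOn.exists_isMinOn ⟨ν₀, ha.le⟩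
    (hcompact (α ν₀).toReal) ((lowerSemicontinuous_of_isCompact hbot hcompact).lowerSemicontinuousOn _)
  have hb : α ν₁ = ((α ν₁).toReal : EReal) :=
    (EReal.coe_toReal (ne_top_of_le_ne_top (EReal.coe_ne_top _) h₁) (hbot _)).symm
  refine ⟨(α ν₁).toReal, fun ν => ?_⟩
  rw [← hb]
  by_cases hν : α ν ≤ ((α ν₀).toReal : EReal)
  · exact hmin hν
  · exact le_trans h₁ (not_le.1 hν).le

lemma isCompact_sublevel_Pw (hψ0 : ∀ x, 0 ≤ ψ x)
    (hcompact : ∀ c : ℝ, IsCompact {ν : ProbabilityMeasure E | α ν ≤ (c : EReal)})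
    {c : ℝ} (h : IsCompact (closure {ν : Pw E ψ | α ν.toProb ≤ (c : EReal)})) :
    IsCompact {ν : Pw E ψ | α ν.toProb ≤ (c : EReal)} := by
  have : IsClosed {ν : Pw E ψ | α ν.toProb ≤ (c : EReal)} :=
    (hcompact c).isClosed.preimage (Pw.continuous_toProb hψ0)
  rwa [this.closure_eq] at h

/-- Near a compact sub-level set, an upper semicontinuous function is controlled by the penalty
of any nearby law, uniformly. -/
lemma exists_finset_forall_le (hbot : ∀ ν, α ν ≠ ⊥)
    (hcompact : ∀ c : ℝ, IsCompact {ν : ProbabilityMeasure E | α ν ≤ (c : EReal)})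
    (hψ0 : ∀ x, 0 ≤ ψ x)
    {F : Pw E ψ → EReal} (hF : UpperSemicontinuous F) {c M : ℝ}
    (hM : (⨆ ν : Pw E ψ, F ν - α ν.toProb) < M)
    (hK : IsCompact {ν : Pw E ψ | α ν.toProb ≤ (c : EReal)}) :
    ∃ s : Finset (E → ℝ), (∀ f ∈ s, IsTest ψ f) ∧ ∃ δ > 0,
      ∀ ν : Pw E ψ, α ν.toProb ≤ (c : EReal) → ∀ μ : Pw E ψ,
        (∀ f ∈ s, |∫ x, f x ∂(μ.toProb : Measure E) - ∫ x, f x ∂(ν.toProb : Measure E)| < δ) →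
          F μ ≤ M + α ν.toProb := by
  refine hK.induction_on (p := fun S => ∃ s : Finset (E → ℝ), (∀ f ∈ s, IsTest ψ f) ∧ ∃ δ > 0,
      ∀ ν ∈ S, ∀ μ : Pw E ψ,
        (∀ f ∈ s, |∫ x, f x ∂(μ.toProb : Measure E) - ∫ x, f x ∂(ν.toProb : Measure E)| < δ) →
          F μ ≤ M + α ν.toProb) ⟨∅, by simp, 1, one_pos, by simp⟩ ?_ ?_ ?_
  · rintro S T hST ⟨s, hs, δ, hδ, h⟩
    exact ⟨s, hs, δ, hδ, fun ν hν => h ν (hST hν)⟩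
  · rintro S T ⟨s, hs, δ, hδ, h⟩ ⟨s', hs', δ', hδ', h'⟩
    refine ⟨s ∪ s', fun f hf => (Finset.mem_union.1 hf).elim (hs f) (hs' f), min δ δ',
      lt_min hδ hδ', ?_⟩
    rintro ν (hν | hν) μ hμ
    · exact h ν hν μ fun f hf =>
        (hμ f (Finset.mem_union_left _ hf)).trans_le (min_le_left _ _)
    · exact h' ν hν μ fun f hf =>
        (hμ f (Finset.mem_union_right _ hf)).trans_le (min_le_right _ _)
  · intro ν hν
    obtain ⟨a, ha⟩ : ∃ a : ℝ, α ν.toProb = a :=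
      ⟨_, (EReal.coe_toReal (ne_top_of_le_ne_top (EReal.coe_ne_top _) hν) (hbot _)).symm⟩
    have hlt : F ν < ((M + a : ℝ) : EReal) := by
      have h1 := (le_iSup (fun ν : Pw E ψ => F ν - α ν.toProb) ν).trans_lt hM
      simp only [ha] at h1
      rw [EReal.sub_lt_iff (by simp) (by simp)] at h1
      rwa [EReal.coe_add]
    obtain ⟨q, hq1, hq2⟩ := EReal.lt_iff_exists_real_btwn.1 hlt
    have hq2' : q - M < a := by have := EReal.coe_lt_coe_iff.1 hq2; linarith
    have hα : LowerSemicontinuous fun μ : Pw E ψ => α μ.toProb :=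
      (lowerSemicontinuous_of_isCompact hbot hcompact).comp (Pw.continuous_toProb hψ0)
    have hnhds : {μ : Pw E ψ | F μ < q} ∩ {μ | ((q - M : ℝ) : EReal) < α μ.toProb} ∈ 𝓝 ν :=
      Filter.inter_mem (hF ν q hq1) (hα ν _ (by simp only [ha]; exact_mod_cast hq2'))
    obtain ⟨s, hs, ε, hε, h⟩ := Pw.exists_finset_of_mem_nhds hnhds
    have hopen : ∀ᶠ ν' in 𝓝 ν, ∀ f ∈ s, |∫ x, f x ∂(ν'.toProb : Measure E) -
        ∫ x, f x ∂(ν.toProb : Measure E)| < ε / 2 := by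
      refine (Filter.eventually_all_finset s).2 fun f hf => ?_
      exact Metric.tendsto_nhds.1 (Pw.continuous_integral (hs f hf)).continuousAt _ (half_pos hε)
    refine ⟨_, mem_nhdsWithin_of_mem_nhds hopen, s, hs, ε / 2, half_pos hε, fun ν' hν' μ hμ => ?_⟩
    have h1 := (h μ fun f hf => ?_).1
    · have h2 := (h ν' fun f hf => (hν' f hf).trans (half_lt_self hε)).2
      refine h1.le.trans ?_
      have : (q : EReal) = M + ((q - M : ℝ) : EReal) := by
        rw [← EReal.coe_add]; congr 1; ring
      rw [this]
      exact add_le_add le_rfl h2.le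
    · have := abs_sub_le (∫ x, f x ∂(μ.toProb : Measure E)) (∫ x, f x ∂(ν'.toProb : Measure E))
        (∫ x, f x ∂(ν.toProb : Measure E))
      linarith [hμ f hf, hν' f hf]

end Penalty

section Disintegration

variable {E : Type*} [MeasurableSpace E]

/-- The coordinates preceding the `k`-th one. -/
def past {n : ℕ} (k : Fin n) (x : Fin n → E) : Fin (k : ℕ) → E :=
  fun i => x (Fin.castLE k.isLt.le i)

lemma measurable_past {n : ℕ} (k : Fin n) : Measurable (past k : (Fin n → E) → Fin (k : ℕ) → E) :=
  measurable_pi_lambda _ fun _ => measurable_pi_apply _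

lemma abs_sub_integral_le {f : E → ℝ} {μ : Measure E} [IsProbabilityMeasure μ] {R : ℝ} (hR : ∀ x, |f x| ≤ R)
    (z : E) : |f z - ∫ y, f y ∂μ| ≤ 2 * R := by
  have h1 : |∫ y, f y ∂μ| ≤ R := by
    have := norm_integral_le_of_norm_le_const (μ := μ) (f := f) (ae_of_all _ hR)
    simpa using this
  linarith [abs_sub (f z) (∫ y, f y ∂μ), hR z]

variable [TopologicalSpace E] [PolishSpace E] [BorelSpace E] [Nonempty E] {n : ℕ}

instance (ν : ProbabilityMeasure (Fin n → E)) (k : Fin n) : IsMarkovKernel (condLaw n ν k) := by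
  unfold condLaw; infer_instance

/-- The conditional law of the `k`-th coordinate, as a kernel on the whole product space. -/
def stepLaw (ν : ProbabilityMeasure (Fin n → E)) (k : Fin n) : Kernel (Fin n → E) E :=
  (condLaw n ν k).comap (past k) (measurable_past k)

instance (ν : ProbabilityMeasure (Fin n → E)) (k : Fin n) : IsMarkovKernel (stepLaw ν k) := by
  unfold stepLaw; infer_instance

lemma map_past_compProd_condLaw (ν : ProbabilityMeasure (Fin n → E)) (k : Fin n) :
    ((ν : Measure (Fin n → E)).map (past k)) ⊗ₘ condLaw n ν k =
      (ν : Measure (Fin n → E)).map fun x => (past k x, x k) := by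
  have h := Measure.disintegrate ((ν : Measure (Fin n → E)).map fun x => (past k x, x k))
    (Measure.condKernel ((ν : Measure (Fin n → E)).map fun x => (past k x, x k)))
  rwa [Measure.fst_map_prodMk (measurable_pi_apply k)] at h

lemma lintegral_stepLaw (ν : ProbabilityMeasure (Fin n → E)) (k : Fin n) {g : E → ℝ≥0∞}
    (hg : Measurable g) :
    ∫⁻ x, g (x k) ∂(ν : Measure (Fin n → E)) =
      ∫⁻ x, ∫⁻ y, g y ∂(stepLaw ν k x) ∂(ν : Measure (Fin n → E)) := by
  have hm : Measurable fun x : Fin n → E => (past k x, x k) :=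
    (measurable_past k).prodMk (measurable_pi_apply k)
  have h1 : ∫⁻ p, g p.2 ∂(ν : Measure (Fin n → E)).map (fun x => (past k x, x k)) =
      ∫⁻ x, g (x k) ∂(ν : Measure (Fin n → E)) :=
    lintegral_map (hg.comp measurable_snd) hm
  rw [← h1, ← map_past_compProd_condLaw, Measure.lintegral_compProd (f := fun p => g p.2) (hg.comp measurable_snd),
    lintegral_map (hg.lintegral_kernel) (measurable_past k)]
  rfl

lemma integral_stepLaw (ν : ProbabilityMeasure (Fin n → E)) (k : Fin n)
    {H : (Fin (k : ℕ) → E) × E → ℝ} (hH : Measurable H) {C : ℝ} (hC : ∀ p, |H p| ≤ C) :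
    ∫ x, H (past k x, x k) ∂(ν : Measure (Fin n → E)) =
      ∫ x, ∫ y, H (past k x, y) ∂(stepLaw ν k x) ∂(ν : Measure (Fin n → E)) := by
  have hm : Measurable fun x : Fin n → E => (past k x, x k) :=
    (measurable_past k).prodMk (measurable_pi_apply k)
  have h1 : ∫ p, H p ∂(ν : Measure (Fin n → E)).map (fun x => (past k x, x k)) =
      ∫ x, H (past k x, x k) ∂(ν : Measure (Fin n → E)) :=
    integral_map hm.aemeasurable hH.aestronglyMeasurable
  have : IsProbabilityMeasure ((ν : Measure (Fin n → E)).map (past k)) :=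
    Measure.isProbabilityMeasure_map (measurable_past k).aemeasurable
  rw [← h1, ← map_past_compProd_condLaw, Measure.integral_compProd,
    integral_map (measurable_past k).aemeasurable]
  · rfl
  · exact (hH.stronglyMeasurable.integral_kernel_prod_right').aestronglyMeasurable
  · exact Integrable.of_bound hH.aestronglyMeasurable C (ae_of_all _ hC)

/-- The deviation of `f (x k)` from its conditional expectation given the preceding coordinates. -/
def deviation (ν : ProbabilityMeasure (Fin n → E)) (f : E → ℝ) (k : Fin n) (x : Fin n → E) : ℝ :=
  f (x k) - ∫ y, f y ∂(stepLaw ν k x)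

variable {f : E → ℝ}

lemma measurable_deviation (ν : ProbabilityMeasure (Fin n → E)) (hf : Measurable f) (k : Fin n) :
    Measurable (deviation ν f k) :=
  (hf.comp (measurable_pi_apply k)).sub (hf.stronglyMeasurable.integral_kernel).measurable

lemma integral_deviation_mul_of_lt (ν : ProbabilityMeasure (Fin n → E)) (hf : Measurable f) {R : ℝ}
    (hR : ∀ x, |f x| ≤ R) {j k : Fin n} (hjk : j < k) :
    ∫ x, deviation ν f j x * deviation ν f k x ∂(ν : Measure (Fin n → E)) = 0 := by
  let r (y : Fin (k : ℕ) → E) : Fin (j : ℕ) → E := fun i => y ⟨i, i.2.trans hjk⟩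
  have hr : Measurable r := measurable_pi_lambda _ fun _ => measurable_pi_apply _
  let G (y : Fin (k : ℕ) → E) : ℝ := f (y ⟨j, hjk⟩) - ∫ z, f z ∂(condLaw n ν j (r y))
  have hG : Measurable G := (hf.comp (measurable_pi_apply _)).sub
    ((hf.stronglyMeasurable.integral_kernel).measurable.comp hr)
  let H (p : (Fin (k : ℕ) → E) × E) : ℝ := G p.1 * (f p.2 - ∫ z, f z ∂(condLaw n ν k p.1))
  have hH : Measurable H := (hG.comp measurable_fst).mul ((hf.comp measurable_snd).sub
    ((hf.stronglyMeasurable.integral_kernel).measurable.comp measurable_fst))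
  have hHb : ∀ p, |H p| ≤ (2 * R) * (2 * R) := by
    intro p
    rw [abs_mul]
    exact mul_le_mul (abs_sub_integral_le hR _) (abs_sub_integral_le hR _) (abs_nonneg _)
      ((abs_nonneg _).trans (abs_sub_integral_le (μ := condLaw n ν k p.1) hR p.2))
  have h := integral_stepLaw ν k hH hHb
  have h0 : ∀ x : Fin n → E, ∫ y, H (past k x, y) ∂(stepLaw ν k x) = 0 := by
    intro x
    have hint : Integrable f (stepLaw ν k x) :=
      Integrable.of_bound hf.aestronglyMeasurable R (ae_of_all _ hR)
    change ∫ y, G (past k x) * (f y - ∫ z, f z ∂(stepLaw ν k x)) ∂(stepLaw ν k x) = 0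
    rw [integral_const_mul, integral_sub hint (integrable_const _)]
    simp
  simp only [h0, integral_zero] at h
  exact h

lemma integral_sq_sum_deviation_le (ν : ProbabilityMeasure (Fin n → E)) (hf : Measurable f) {R : ℝ}
    (hR : ∀ x, |f x| ≤ R) :
    ∫ x, (∑ k, deviation ν f k x) ^ 2 ∂(ν : Measure (Fin n → E)) ≤ 4 * R ^ 2 * n := by
  have hb : ∀ j k x, |deviation ν f j x * deviation ν f k x| ≤ (2 * R) * (2 * R) := by
    intro j k x
    rw [abs_mul]
    exact mul_le_mul (abs_sub_integral_le hR _) (abs_sub_integral_le hR _) (abs_nonneg _)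
      ((abs_nonneg _).trans (abs_sub_integral_le (μ := stepLaw ν k x) hR (x k)))
  have hint : ∀ j k, Integrable (fun x => deviation ν f j x * deviation ν f k x)
      (ν : Measure (Fin n → E)) := fun j k =>
    Integrable.of_bound ((measurable_deviation ν hf j).mul
      (measurable_deviation ν hf k)).aestronglyMeasurable _ (ae_of_all _ (hb j k))
  simp only [sq (∑ k, deviation ν f k _), Finset.sum_mul_sum]
  rw [integral_finsetSum _ fun j _ => integrable_finsetSum _ fun k _ => hint j k]
  calc _ = ∑ j, ∑ k, ∫ x, deviation ν f j x * deviation ν f k x ∂(ν : Measure (Fin n → E)) :=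
        Finset.sum_congr rfl fun j _ => integral_finsetSum _ fun k _ => hint j k
    _ ≤ ∑ j : Fin n, ∑ k : Fin n, if j = k then 4 * R ^ 2 else 0 := by
        refine Finset.sum_le_sum fun j _ => Finset.sum_le_sum fun k _ => ?_
        rcases lt_trichotomy j k with h | rfl | h
        · rw [integral_deviation_mul_of_lt ν hf hR h, if_neg h.ne]
        · rw [if_pos rfl]
          have h1 := integral_mono (hint j j) (integrable_const _)
            fun x => (le_abs_self _).trans (hb j j x)
          simp only [integral_const, probReal_univ, one_smul] at h1
          linarith
        · simp only [mul_comm (deviation ν f j _)]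
          rw [integral_deviation_mul_of_lt ν hf hR h, if_neg h.ne']
    _ = 4 * R ^ 2 * n := by simp; ring

lemma integral_abs_average_deviation_le_of_bounded (ν : ProbabilityMeasure (Fin n → E))
    (hn : n ≠ 0) (hf : Measurable f) {R : ℝ} (hR : ∀ x, |f x| ≤ R) {θ : ℝ} (hθ : 0 < θ) :
    ∫ x, |(n : ℝ)⁻¹ * ∑ k, deviation ν f k x| ∂(ν : Measure (Fin n → E)) ≤
      θ + R ^ 2 / (n * θ) := by
  have hn' : (0 : ℝ) < n := by positivity
  have hm : Measurable fun x => ∑ k, deviation ν f k x :=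
    Finset.measurable_fun_sum _ fun k _ => measurable_deviation ν hf k
  have hb : ∀ x, |∑ k, deviation ν f k x| ≤ n * (2 * R) := by
    intro x
    refine (Finset.abs_sum_le_sum_abs _ _).trans ?_
    refine (Finset.sum_le_sum fun k _ => abs_sub_integral_le (μ := stepLaw ν k x) hR (x k)).trans ?_
    simp
  have hsq : Integrable (fun x => (∑ k, deviation ν f k x) ^ 2) (ν : Measure (Fin n → E)) :=
    Integrable.of_bound (hm.pow_const 2).aestronglyMeasurable ((n * (2 * R)) ^ 2)
      (ae_of_all _ fun x => by
        rw [Real.norm_eq_abs, abs_pow]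
        exact pow_le_pow_left₀ (abs_nonneg _) (hb x) 2)
  calc _ ≤ ∫ x, (θ + (4 * θ * n ^ 2)⁻¹ * (∑ k, deviation ν f k x) ^ 2)
        ∂(ν : Measure (Fin n → E)) := by
        refine integral_mono ?_ ((integrable_const _).add (hsq.const_mul _)) fun x => ?_
        · exact Integrable.of_bound (hm.const_mul _).abs.aestronglyMeasurable
            ((n : ℝ)⁻¹ * (n * (2 * R))) (ae_of_all _ fun x => by
              rw [Real.norm_eq_abs, abs_abs, abs_mul, abs_of_pos (inv_pos.2 hn')]
              exact mul_le_mul_of_nonneg_left (hb x) (inv_pos.2 hn').le)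
        · set u := (n : ℝ)⁻¹ * ∑ k, deviation ν f k x with hu
          have h1 : (4 * θ * (n : ℝ) ^ 2)⁻¹ * (∑ k, deviation ν f k x) ^ 2 = u ^ 2 / (4 * θ) := by
            rw [hu]; field_simp
          simp only [h1]
          have h2 : θ + u ^ 2 / (4 * θ) - |u| = (2 * θ - |u|) ^ 2 / (4 * θ) := by
            rw [← sq_abs u]; field_simp; ring
          have h3 : 0 ≤ (2 * θ - |u|) ^ 2 / (4 * θ) := by positivity
          linarith
    _ = θ + (4 * θ * n ^ 2)⁻¹ *
        ∫ x, (∑ k, deviation ν f k x) ^ 2 ∂(ν : Measure (Fin n → E)) := by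
        rw [integral_add (integrable_const _) (hsq.const_mul _), integral_const_mul]
        simp
    _ ≤ θ + (4 * θ * n ^ 2)⁻¹ * (4 * R ^ 2 * n) := by
        gcongr
        exact integral_sq_sum_deviation_le ν hf hR
    _ = θ + R ^ 2 / (n * θ) := by field_simp

end Disintegration

section Deviation

lemma abs_sub_clamp_le {E : Type*} {ψ f : E → ℝ} (hf : ∀ x, |f x| ≤ 1 + ψ x) (R : ℕ) (x : E) :
    |f x - max (min (f x) R) (-R)| ≤ excess ψ R x := by
  have h := abs_le.1 (hf x)
  have hR : (0 : ℝ) ≤ R := by positivity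
  have h1 : 1 + ψ x - R ≤ excess ψ R x := le_max_left _ _
  have h2 : 0 ≤ excess ψ R x := excess_nonneg R x
  rw [abs_le]
  rcases max_cases (min (f x) R) (-R : ℝ) with h3 | h3 <;>
    rcases min_cases (f x) (R : ℝ) with h4 | h4 <;> constructor <;> linarith

variable {E : Type*} [MeasurableSpace E] [TopologicalSpace E] [PolishSpace E] [BorelSpace E]
  [Nonempty E] {n : ℕ} {ψ : E → ℝ} {α : ProbabilityMeasure E → EReal}

lemma integral_abs_average_deviation_le (hψc : Continuous ψ) (hψ0 : ∀ x, 0 ≤ ψ x) {b η : ℝ}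
    (hb : ∀ ν, (b : EReal) ≤ α ν) (hη : 0 < η) {R : ℕ}
    (hfin : ∀ (c : ℝ) (ν : ProbabilityMeasure E), α ν ≤ (c : EReal) →
      ∫⁻ x, ENNReal.ofReal (ψ x) ∂(ν : Measure E) ≠ ⊤)
    (hR : ∀ (μ : ProbabilityMeasure E) (a : ℝ), α μ = a →
      ∫⁻ x, ENNReal.ofReal (excess ψ R x) ∂(μ : Measure E) ≤ ENNReal.ofReal (η * (a - b + 1)))
    (hn : n ≠ 0) (ν : ProbabilityMeasure (Fin n → E)) {a : Fin n → (Fin n → E) → ℝ}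
    (ha : ∀ k, ∀ᵐ x ∂(ν : Measure (Fin n → E)), extend α (stepLaw ν k x) = a k x)
    (hint : ∀ k, Integrable (a k) (ν : Measure (Fin n → E))) {f : E → ℝ} (hf : IsTest ψ f)
    {θ : ℝ} (hθ : 0 < θ) :
    Integrable (fun x => |(n : ℝ)⁻¹ * ∑ k, deviation ν f k x|) (ν : Measure (Fin n → E)) ∧
      ∫ x, |(n : ℝ)⁻¹ * ∑ k, deviation ν f k x| ∂(ν : Measure (Fin n → E)) ≤
        θ + (R : ℝ) ^ 2 / (n * θ) +
          2 * η * ((n : ℝ)⁻¹ * (∑ k, ∫ x, a k x ∂(ν : Measure (Fin n → E))) - b + 1) := by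
  have hn' : (0 : ℝ) < n := by positivity
  have hfm := hf.1.measurable
  set h : E → ℝ := fun x => max (min (f x) R) (-R) with hh
  have hhm : Measurable h := (hfm.min measurable_const).max measurable_const
  have hhR : ∀ x, |h x| ≤ R := fun x => by
    have : (0 : ℝ) ≤ R := by positivity
    exact abs_le.2 ⟨le_max_right _ _, max_le (min_le_right _ _) (by linarith)⟩
  have hem : Measurable (excess ψ R) := (isTest_excess hψc hψ0 R).1.measurable
  have hba : ∀ k, ∀ᵐ x ∂(ν : Measure (Fin n → E)), b ≤ a k x := fun k => by
    filter_upwards [ha k] with x hx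
    rw [← EReal.coe_le_coe_iff, ← hx, extend_eq]
    exact hb _
  have hexc : ∀ k, ∀ᵐ x ∂(ν : Measure (Fin n → E)),
      ∫⁻ y, ENNReal.ofReal (excess ψ R y) ∂(stepLaw ν k x) ≤
        ENNReal.ofReal (η * (a k x - b + 1)) := fun k => by
    filter_upwards [ha k] with x hx
    rw [extend_eq] at hx
    exact hR _ _ hx
  have hint' : ∀ k, Integrable (fun x => η * (a k x - b + 1)) (ν : Measure (Fin n → E)) :=
    fun k => (((hint k).sub (integrable_const b)).add (integrable_const 1)).const_mul η
  have hl : ∀ k, ∫⁻ x, ENNReal.ofReal (excess ψ R (x k)) ∂(ν : Measure (Fin n → E)) ≤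
      ENNReal.ofReal (∫ x, η * (a k x - b + 1) ∂(ν : Measure (Fin n → E))) := by
    intro k
    rw [lintegral_stepLaw ν k (g := fun y => ENNReal.ofReal (excess ψ R y)) (by fun_prop),
      ofReal_integral_eq_lintegral_ofReal (hint' k)]
    · exact lintegral_mono_ae (hexc k)
    · filter_upwards [hba k] with x hx
      have : 0 ≤ a k x - b + 1 := by linarith
      exact mul_nonneg hη.le this
  have hnn : ∀ k, 0 ≤ ∫ x, η * (a k x - b + 1) ∂(ν : Measure (Fin n → E)) := fun k =>
    integral_nonneg_of_ae (by
      filter_upwards [hba k] with x hx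
      exact mul_nonneg hη.le (by linarith))
  have hei : ∀ k, Integrable (fun x : Fin n → E => excess ψ R (x k))
      (ν : Measure (Fin n → E)) := by
    intro k
    refine ⟨(hem.comp (measurable_pi_apply k)).aestronglyMeasurable, ?_⟩
    rw [hasFiniteIntegral_iff_ofReal (ae_of_all _ fun x => excess_nonneg R _)]
    exact (hl k).trans_lt ENNReal.ofReal_lt_top
  have hel : ∀ k, ∫ x, excess ψ R (x k) ∂(ν : Measure (Fin n → E)) ≤
      ∫ x, η * (a k x - b + 1) ∂(ν : Measure (Fin n → E)) := by
    intro k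
    have h1 := hl k
    rw [← ofReal_integral_eq_lintegral_ofReal (hei k) (ae_of_all _ fun x => excess_nonneg R _)]
      at h1
    exact (ENNReal.ofReal_le_ofReal_iff (hnn k)).1 h1
  have hdev : ∀ k, ∀ᵐ x ∂(ν : Measure (Fin n → E)), |deviation ν f k x - deviation ν h k x| ≤
      excess ψ R (x k) + η * (a k x - b + 1) := by
    intro k
    filter_upwards [ha k, hexc k, hba k] with x hx hxe hxb
    rw [extend_eq] at hx
    let μ : Pw E ψ := Pw.ofProb ⟨stepLaw ν k x, inferInstance⟩ (hfin _ _ hx.le)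
    have hfi : Integrable f (stepLaw ν k x) := μ.integrable hψc hψ0 hf
    have hei : Integrable (excess ψ R) (stepLaw ν k x) :=
      μ.integrable hψc hψ0 (isTest_excess hψc hψ0 R)
    have hhi : Integrable h (stepLaw ν k x) :=
      Integrable.of_bound hhm.aestronglyMeasurable R (ae_of_all _ hhR)
    have h1 : |∫ y, f y ∂(stepLaw ν k x) - ∫ y, h y ∂(stepLaw ν k x)| ≤
        η * (a k x - b + 1) := by
      rw [← integral_sub hfi hhi]
      refine abs_integral_le_integral_abs.trans ?_
      refine (integral_mono (hfi.sub hhi).abs hei fun y => abs_sub_clamp_le hf.2 R y).trans ?_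
      rw [← ofReal_integral_eq_lintegral_ofReal hei (ae_of_all _ fun x => excess_nonneg R _)] at hxe
      exact (ENNReal.ofReal_le_ofReal_iff (mul_nonneg hη.le (by linarith))).1 hxe
    have h2 := abs_sub_clamp_le hf.2 R (x k)
    have h3 : deviation ν f k x - deviation ν h k x =
        (f (x k) - h (x k)) - (∫ y, f y ∂(stepLaw ν k x) - ∫ y, h y ∂(stepLaw ν k x)) := by
      simp only [deviation]; ring
    rw [h3]
    exact (abs_sub _ _).trans (add_le_add h2 h1)
  let B (x : Fin n → E) : ℝ := |(n : ℝ)⁻¹ * ∑ k, deviation ν h k x| +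
    (n : ℝ)⁻¹ * ∑ k, (excess ψ R (x k) + η * (a k x - b + 1))
  have hBi1 : Integrable (fun x => |(n : ℝ)⁻¹ * ∑ k, deviation ν h k x|)
      (ν : Measure (Fin n → E)) := by
    refine ((integrable_finsetSum _ fun k _ => ?_).const_mul _).abs
    exact Integrable.of_bound (measurable_deviation ν hhm k).aestronglyMeasurable (2 * R)
      (ae_of_all _ fun x => abs_sub_integral_le (μ := stepLaw ν k x) hhR (x k))
  have hBi2 : Integrable (fun x => (n : ℝ)⁻¹ * ∑ k, (excess ψ R (x k) + η * (a k x - b + 1)))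
      (ν : Measure (Fin n → E)) :=
    (integrable_finsetSum _ fun k _ => (hei k).add (hint' k)).const_mul _
  have hBi : Integrable B (ν : Measure (Fin n → E)) := hBi1.add hBi2
  have hle : ∀ᵐ x ∂(ν : Measure (Fin n → E)), |(n : ℝ)⁻¹ * ∑ k, deviation ν f k x| ≤ B x := by
    filter_upwards [ae_all_iff.2 hdev] with x hx
    have h1 : (n : ℝ)⁻¹ * ∑ k, deviation ν f k x = (n : ℝ)⁻¹ * ∑ k, deviation ν h k x +
        (n : ℝ)⁻¹ * ∑ k, (deviation ν f k x - deviation ν h k x) := by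
      rw [Finset.sum_sub_distrib]; ring
    rw [h1]
    refine (abs_add_le _ _).trans (add_le_add le_rfl ?_)
    rw [abs_mul, abs_of_pos (inv_pos.2 hn')]
    exact mul_le_mul_of_nonneg_left ((Finset.abs_sum_le_sum_abs _ _).trans
      (Finset.sum_le_sum fun k _ => hx k)) (inv_pos.2 hn').le
  have hfi : Integrable (fun x => |(n : ℝ)⁻¹ * ∑ k, deviation ν f k x|)
      (ν : Measure (Fin n → E)) := by
    refine hBi.mono' ?_ (hle.mono fun x hx => ?_)
    · exact ((Finset.measurable_fun_sum _ fun k _ =>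
        measurable_deviation ν hfm k).const_mul _).abs.aestronglyMeasurable
    · rwa [Real.norm_eq_abs, abs_abs]
  refine ⟨hfi, (integral_mono_ae hfi hBi hle).trans ?_⟩
  have hsum : ∫ x, ∑ k, (excess ψ R (x k) + η * (a k x - b + 1)) ∂(ν : Measure (Fin n → E)) =
      ∑ k, ∫ x, (excess ψ R (x k) + η * (a k x - b + 1)) ∂(ν : Measure (Fin n → E)) :=
    integral_finsetSum _ fun k _ => (hei k).add (hint' k)
  rw [integral_add hBi1 hBi2, integral_const_mul, hsum]
  refine add_le_add (integral_abs_average_deviation_le_of_bounded ν hn hhm hhR hθ) ?_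
  have h1 : ∀ k, ∫ x, (excess ψ R (x k) + η * (a k x - b + 1)) ∂(ν : Measure (Fin n → E)) ≤
      2 * η * ((∫ x, a k x ∂(ν : Measure (Fin n → E))) - b + 1) := by
    intro k
    rw [integral_add (hei k) (hint' k)]
    have h2 : ∫ x, η * (a k x - b + 1) ∂(ν : Measure (Fin n → E)) =
        η * ((∫ x, a k x ∂(ν : Measure (Fin n → E))) - b + 1) := by
      have h3 : Integrable (fun x => a k x - b) (ν : Measure (Fin n → E)) :=
        (hint k).sub (integrable_const b)
      rw [integral_const_mul, integral_add h3 (integrable_const 1),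
        integral_sub (hint k) (integrable_const b)]
      simp
    have := hel k
    rw [h2] at this ⊢
    linarith
  calc _ ≤ (n : ℝ)⁻¹ * ∑ k, 2 * η * ((∫ x, a k x ∂(ν : Measure (Fin n → E))) - b + 1) :=
        mul_le_mul_of_nonneg_left (Finset.sum_le_sum fun k _ => h1 k) (inv_pos.2 hn').le
    _ = _ := by
        rw [← Finset.mul_sum, Finset.sum_add_distrib, Finset.sum_sub_distrib]
        simp
        field_simp

end Deviation

section UpperBound

lemma ereal_coe_sum {ι : Type*} (s : Finset ι) (f : ι → ℝ) :
    ((∑ i ∈ s, f i : ℝ) : EReal) = ∑ i ∈ s, (f i : EReal) := by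
  induction s using Finset.cons_induction with
  | empty => simp
  | cons i s hi ih => rw [Finset.sum_cons, Finset.sum_cons, EReal.coe_add, ih]

lemma ereal_sum_ne_bot {ι : Type*} (s : Finset ι) {f : ι → EReal} (h : ∀ i ∈ s, f i ≠ ⊥) :
    ∑ i ∈ s, f i ≠ ⊥ := by
  induction s using Finset.cons_induction with
  | empty => simp
  | cons i s hi ih =>
    rw [Finset.sum_cons, EReal.add_ne_bot_iff]
    exact ⟨h i (Finset.mem_cons_self i s), ih fun j hj => h j (Finset.mem_cons_of_mem hj)⟩

lemma ereal_sum_eq_top {ι : Type*} [Fintype ι] {f : ι → EReal} (h : ∀ i, f i ≠ ⊥) {i : ι}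
    (hi : f i = ⊤) : ∑ i, f i = ⊤ := by
  classical
  rw [← Finset.add_sum_erase _ _ (Finset.mem_univ i), hi]
  exact EReal.top_add_of_ne_bot (ereal_sum_ne_bot _ fun j _ => h j)

variable {E : Type*} [MeasurableSpace E] [TopologicalSpace E] [PolishSpace E] [BorelSpace E]
  [Nonempty E] {n : ℕ} {ψ : E → ℝ} {α : ProbabilityMeasure E → EReal}

lemma apply_empirical_le
    (hconvex : ∀ (μ₁ μ₂ : ProbabilityMeasure E) (t : ℝ≥0), t ≤ 1 →
      extend α ((t : ℝ≥0∞) • (μ₁ : Measure E) + ((1 - t : ℝ≥0) : ℝ≥0∞) • (μ₂ : Measure E))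
        ≤ ((t : ℝ) : EReal) * α μ₁ + (((1 - t : ℝ≥0) : ℝ) : EReal) * α μ₂)
    (hψc : Continuous ψ) (hψ0 : ∀ x, 0 ≤ ψ x)
    (hfin : ∀ (c : ℝ) (ν : ProbabilityMeasure E), α ν ≤ (c : EReal) →
      ∫⁻ x, ENNReal.ofReal (ψ x) ∂(ν : Measure E) ≠ ⊤)
    {b C M D δ : ℝ} (hb : ∀ ν, (b : EReal) ≤ α ν) {F : Pw E ψ → EReal}
    (hC : ∀ ν, F ν ≤ (C : EReal)) {s : Finset (E → ℝ)} (hs : ∀ f ∈ s, IsTest ψ f) (hδ : 0 < δ)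
    (hF : ∀ ν : Pw E ψ, α ν.toProb ≤ ((C - M : ℝ) : EReal) → ∀ μ : Pw E ψ,
      (∀ f ∈ s, |∫ x, f x ∂(μ.toProb : Measure E) - ∫ x, f x ∂(ν.toProb : Measure E)| < δ) →
        F μ ≤ M + α ν.toProb)
    (hD0 : 0 ≤ D) (hD : C - M - b ≤ D) (hn : n ≠ 0) (ν : ProbabilityMeasure (Fin n → E))
    {x : Fin n → E} {a : Fin n → ℝ} (ha : ∀ k, extend α (stepLaw ν k x) = a k) :
    F (Pw.empirical hψc hn x) ≤ ((M + (n : ℝ)⁻¹ * ∑ k, a k +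
      D / δ * ∑ f ∈ s, |(n : ℝ)⁻¹ * ∑ k, deviation ν f k x| : ℝ) : EReal) := by
  have hT : 0 ≤ ∑ f ∈ s, |(n : ℝ)⁻¹ * ∑ k, deviation ν f k x| :=
    Finset.sum_nonneg fun f _ => abs_nonneg _
  have hDT : 0 ≤ D / δ * ∑ f ∈ s, |(n : ℝ)⁻¹ * ∑ k, deviation ν f k x| := by positivity
  simp only [extend_eq] at ha
  obtain ⟨m, hm, hαm⟩ := extend_average_le hconvex hn fun k => (ha k).le
  have hba := EReal.coe_le_coe_iff.1 ((hb m).trans hαm)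
  by_cases hc : (n : ℝ)⁻¹ * ∑ k, a k ≤ C - M
  · by_cases hclose : ∀ f ∈ s, |(n : ℝ)⁻¹ * ∑ k, deviation ν f k x| < δ
    · refine (hF (Pw.ofProb m (hfin _ m hαm)) (hαm.trans (EReal.coe_le_coe_iff.2 hc)) _
        fun f hf => ?_).trans ((add_le_add_right hαm _).trans ?_)
      · refine lt_of_eq_of_lt ?_ (hclose f hf)
        have hint : ∀ k, Integrable f (stepLaw ν k x) := fun k =>
          Pw.integrable hψc hψ0 (Pw.ofProb ⟨stepLaw ν k x, inferInstance⟩ (hfin _ _ (ha k).le))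
            (hs f hf)
        have h1 : ∫ y, f y ∂(m : Measure E) = (n : ℝ)⁻¹ * ∑ k, ∫ y, f y ∂(stepLaw ν k x) := by
          have hm' : (m : Measure E) = (n : ℝ≥0∞)⁻¹ • ∑ k, stepLaw ν k x := hm
          rw [hm', integral_smul_measure, integral_finsetSum_measure fun k _ => hint k]
          simp
        rw [Pw.integral_empirical hψc hn x (hs f hf).1.measurable]
        change |_ - ∫ y, f y ∂(m : Measure E)| = _
        rw [h1]
        simp only [deviation, Finset.sum_sub_distrib, mul_sub]
      · rw [← EReal.coe_add, EReal.coe_le_coe_iff]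
        linarith
    · push Not at hclose
      obtain ⟨f, hf, hfδ⟩ := hclose
      refine (hC _).trans (EReal.coe_le_coe_iff.2 ?_)
      have h1 : δ ≤ ∑ f ∈ s, |(n : ℝ)⁻¹ * ∑ k, deviation ν f k x| :=
        hfδ.trans (Finset.single_le_sum
          (f := fun f => |(n : ℝ)⁻¹ * ∑ k, deviation ν f k x|) (fun f _ => abs_nonneg _) hf)
      have h2 : D ≤ D / δ * ∑ f ∈ s, |(n : ℝ)⁻¹ * ∑ k, deviation ν f k x| := by
        calc D = D / δ * δ := by field_simp
          _ ≤ _ := mul_le_mul_of_nonneg_left h1 (by positivity)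
      linarith
  · exact (hC _).trans (EReal.coe_le_coe_iff.2 (by linarith))

lemma erealIntegral_sub_alphan_le (hbot : ∀ ν, α ν ≠ ⊥)
    (hconvex : ∀ (μ₁ μ₂ : ProbabilityMeasure E) (t : ℝ≥0), t ≤ 1 →
      extend α ((t : ℝ≥0∞) • (μ₁ : Measure E) + ((1 - t : ℝ≥0) : ℝ≥0∞) • (μ₂ : Measure E))
        ≤ ((t : ℝ) : EReal) * α μ₁ + (((1 - t : ℝ≥0) : ℝ) : EReal) * α μ₂)
    (hcompact : ∀ c : ℝ, IsCompact {ν : ProbabilityMeasure E | α ν ≤ (c : EReal)})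
    (hψc : Continuous ψ) (hψ0 : ∀ x, 0 ≤ ψ x)
    (hfin : ∀ (c : ℝ) (ν : ProbabilityMeasure E), α ν ≤ (c : EReal) →
      ∫⁻ x, ENNReal.ofReal (ψ x) ∂(ν : Measure E) ≠ ⊤)
    {b C M M' D δ η θ ε : ℝ} {R : ℕ} (hb : ∀ ν, (b : EReal) ≤ α ν) {F : Pw E ψ → EReal}
    (hC : ∀ ν, F ν ≤ (C : EReal)) {s : Finset (E → ℝ)} (hs : ∀ f ∈ s, IsTest ψ f) (hδ : 0 < δ)
    (hF : ∀ ν : Pw E ψ, α ν.toProb ≤ ((C - M : ℝ) : EReal) → ∀ μ : Pw E ψ,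
      (∀ f ∈ s, |∫ x, f x ∂(μ.toProb : Measure E) - ∫ x, f x ∂(ν.toProb : Measure E)| < δ) →
        F μ ≤ M + α ν.toProb)
    (hD0 : 0 ≤ D) (hD : C - M - b ≤ D) (hη : 0 < η) (hθ : 0 < θ) (hMM' : M ≤ M')
    (hR : ∀ (μ : ProbabilityMeasure E) (a : ℝ), α μ = a →
      ∫⁻ x, ENNReal.ofReal (excess ψ R x) ∂(μ : Measure E) ≤ ENNReal.ofReal (η * (a - b + 1)))
    (hn : n ≠ 0) (hε : θ + (R : ℝ) ^ 2 / (n * θ) + 2 * η * (C - M - b + 1) ≤ ε)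
    (hM' : M + D / δ * (s.card * ε) ≤ M') (ν : ProbabilityMeasure (Fin n → E)) :
    erealIntegral (ν : Measure (Fin n → E))
        (fun x => ((n : ℝ) : EReal) * liftPw ψ F (empirical n x)) - alphan α n ν ≤
      ((n * M' : ℝ) : EReal) := by
  have hn' : (0 : ℝ) < n := by positivity
  have hα : alphan α n ν = ∑ k, erealIntegral (ν : Measure (Fin n → E))
    fun x => extend α (stepLaw ν k x) := rfl
  simp only [liftPw_empirical hψc hn]
  have hbk : ∀ k, (b : EReal) ≤ erealIntegral (ν : Measure (Fin n → E))
      fun x => extend α (stepLaw ν k x) := by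
    intro k
    rw [← erealIntegral_const (μ := (ν : Measure (Fin n → E))) b]
    exact erealIntegral_mono (ae_of_all _ fun x => by rw [extend_eq]; exact hb _)
  have hbotk : ∀ k, erealIntegral (ν : Measure (Fin n → E))
      (fun x => extend α (stepLaw ν k x)) ≠ ⊥ :=
    fun k => ne_bot_of_le_ne_bot (EReal.coe_ne_bot b) (hbk k)
  by_cases htop : ∃ k, erealIntegral (ν : Measure (Fin n → E))
      (fun x => extend α (stepLaw ν k x)) = ⊤
  · obtain ⟨k, hk⟩ := htop
    rw [hα, ereal_sum_eq_top hbotk hk, EReal.sub_top]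
    exact bot_le
  push Not at htop
  have hreal := fun k => integrable_toReal_of_erealIntegral
    (measurable_extend_kernel α hbot hcompact (stepLaw ν k)) (htop k) (hbotk k)
  set a : Fin n → (Fin n → E) → ℝ := fun k x => (extend α (stepLaw ν k x)).toReal
  have ha : ∀ k, ∀ᵐ x ∂(ν : Measure (Fin n → E)), extend α (stepLaw ν k x) = a k x :=
    fun k => (hreal k).1
  have hint : ∀ k, Integrable (a k) (ν : Measure (Fin n → E)) := fun k => (hreal k).2
  have hαr : alphan α n ν = ((∑ k, ∫ x, a k x ∂(ν : Measure (Fin n → E)) : ℝ) : EReal) := by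
    rw [hα, ereal_coe_sum]
    exact Finset.sum_congr rfl fun k _ => by
      rw [erealIntegral_congr_ae (ha k), erealIntegral_coe (hint k)]
  set S : ℝ := ∑ k, ∫ x, a k x ∂(ν : Measure (Fin n → E)) with hS
  rw [hαr, EReal.sub_le_iff_le_add (by simp) (by simp), ← EReal.coe_add]
  have hn0 : (0 : EReal) ≤ ((n : ℝ) : EReal) := by exact_mod_cast hn'.le
  by_cases hA : C - M ≤ (n : ℝ)⁻¹ * S
  · refine (erealIntegral_mono (ae_of_all _ fun x =>
      mul_le_mul_of_nonneg_left (hC _) hn0)).trans ?_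
    simp only [← EReal.coe_mul]
    rw [erealIntegral_const, EReal.coe_le_coe_iff]
    have h1 : n * (C - M) ≤ S := by
      rwa [inv_mul_eq_div, le_div_iff₀ hn', mul_comm] at hA
    nlinarith
  · push Not at hA
    have hdev := fun f hf => integral_abs_average_deviation_le hψc hψ0 hb hη hfin hR hn ν ha hint
      (hs f hf) hθ
    have hi1 : Integrable (fun x => M + (n : ℝ)⁻¹ * ∑ k, a k x) (ν : Measure (Fin n → E)) :=
      (integrable_const M).add ((integrable_finsetSum _ fun k _ => hint k).const_mul _)
    have hi2 : Integrable (fun x => D / δ * ∑ f ∈ s, |(n : ℝ)⁻¹ * ∑ k, deviation ν f k x|)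
        (ν : Measure (Fin n → E)) :=
      (integrable_finsetSum _ fun f hf => (hdev f hf).1).const_mul _
    have hi : Integrable (fun x => n * (M + (n : ℝ)⁻¹ * ∑ k, a k x +
        D / δ * ∑ f ∈ s, |(n : ℝ)⁻¹ * ∑ k, deviation ν f k x|)) (ν : Measure (Fin n → E)) :=
      (hi1.add hi2).const_mul (n : ℝ)
    have hpt : ∀ᵐ x ∂(ν : Measure (Fin n → E)),
        ((n : ℝ) : EReal) * F (Pw.empirical hψc hn x) ≤ ((n * (M + (n : ℝ)⁻¹ * ∑ k, a k x +
          D / δ * ∑ f ∈ s, |(n : ℝ)⁻¹ * ∑ k, deviation ν f k x|) : ℝ) : EReal) := by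
      filter_upwards [ae_all_iff.2 ha] with x hx
      rw [EReal.coe_mul]
      exact mul_le_mul_of_nonneg_left
        (apply_empirical_le hconvex hψc hψ0 hfin hb hC hs hδ hF hD0 hD hn ν hx) hn0
    refine (erealIntegral_mono hpt).trans ?_
    rw [erealIntegral_coe hi, EReal.coe_le_coe_iff, integral_const_mul, integral_add hi1 hi2,
      integral_const_mul, integral_finsetSum _ fun f hf => (hdev f hf).1,
      integral_add (integrable_const M) ((integrable_finsetSum _ fun k _ => hint k).const_mul _),
      integral_const_mul, integral_finsetSum _ fun k _ => hint k, ← hS]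
    have h2 : ∑ f ∈ s, ∫ x, |(n : ℝ)⁻¹ * ∑ k, deviation ν f k x| ∂(ν : Measure (Fin n → E)) ≤
        s.card * ε := by
      refine (Finset.sum_le_card_nsmul _ _ ε fun f hf => (hdev f hf).2.trans
        (le_trans ?_ hε)).trans_eq (nsmul_eq_mul _ _)
      gcongr
    have h3 := mul_le_mul_of_nonneg_left h2 (div_nonneg hD0 hδ.le)
    have h4 : n * ((n : ℝ)⁻¹ * S) = S := mul_inv_cancel_left₀ hn'.ne' _
    simp only [integral_const, probReal_univ, one_smul]
    have h5 := mul_le_mul_of_nonneg_left (add_le_add_right h3 M |>.trans hM') hn'.le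
    linarith

lemma limsup_rhon_le_iSup_sub (hproper : ∃ ν, α ν ≠ ⊤) (hbot : ∀ ν, α ν ≠ ⊥)
    (hconvex : ∀ (μ₁ μ₂ : ProbabilityMeasure E) (t : ℝ≥0), t ≤ 1 →
      extend α ((t : ℝ≥0∞) • (μ₁ : Measure E) + ((1 - t : ℝ≥0) : ℝ≥0∞) • (μ₂ : Measure E))
        ≤ ((t : ℝ) : EReal) * α μ₁ + (((1 - t : ℝ≥0) : ℝ) : EReal) * α μ₂)
    (hcompact : ∀ c : ℝ, IsCompact {ν : ProbabilityMeasure E | α ν ≤ (c : EReal)})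
    (hψc : Continuous ψ) (hψ0 : ∀ x, 0 ≤ ψ x)
    (hfin : ∀ (c : ℝ) (ν : ProbabilityMeasure E), α ν ≤ (c : EReal) →
      ∫⁻ x, ENNReal.ofReal (ψ x) ∂(ν : Measure E) ≠ ⊤)
    (hK : ∀ c : ℝ, IsCompact {ν : Pw E ψ | α ν.toProb ≤ (c : EReal)})
    {F : Pw E ψ → EReal} (hF : UpperSemicontinuous F) {C : ℝ} (hC : ∀ ν, F ν ≤ (C : EReal)) :
    Filter.limsup (fun n : ℕ => (((n : ℝ)⁻¹ : ℝ) : EReal) *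
        rhon α n fun x => ((n : ℝ) : EReal) * liftPw ψ F (empirical n x)) Filter.atTop ≤
      ⨆ ν : Pw E ψ, F ν - α ν.toProb := by
  refine EReal.le_of_forall_lt_iff_le.1 fun M' hM' => ?_
  obtain ⟨M, hM, hMM'⟩ := EReal.lt_iff_exists_real_btwn.1 hM'
  have hlt : M < M' := EReal.coe_lt_coe_iff.1 hMM'
  obtain ⟨b, hb⟩ := exists_real_le hbot hcompact
  obtain ⟨s, hs, δ, hδ, hsF⟩ := exists_finset_forall_le hbot hcompact hψ0 hF hM (hK (C - M))
  set D : ℝ := |C - M - b|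
  have hQ : 0 ≤ D / δ * s.card := by positivity
  set ε : ℝ := (M' - M) / (D / δ * s.card + 1) with hε
  have hε0 : 0 < ε := div_pos (by linarith) (by linarith)
  have hB : 0 < D + 1 := by positivity
  set η : ℝ := ε / (6 * (D + 1)) with hη
  have hη0 : 0 < η := by positivity
  obtain ⟨R, hR⟩ := exists_lintegral_excess_le hproper hbot hconvex hψc hψ0 hfin hK hb hη0
  have hθ0 : 0 < ε / 3 := by positivity
  have hlim : Tendsto (fun n : ℕ => (R : ℝ) ^ 2 / (n * (ε / 3))) atTop (𝓝 0) :=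
    Tendsto.const_div_atTop (tendsto_natCast_atTop_atTop.atTop_mul_const hθ0) _
  refine Filter.limsup_le_of_le (h := ?_)
  filter_upwards [eventually_ne_atTop 0, hlim.eventually (gt_mem_nhds hθ0)] with n hn hnR
  have hn' : (0 : ℝ) < n := by positivity
  have hle : rhon α n (fun x => ((n : ℝ) : EReal) * liftPw ψ F (empirical n x)) ≤
      ((n * M' : ℝ) : EReal) := by
    refine iSup_le fun ν => erealIntegral_sub_alphan_le hbot hconvex hcompact hψc hψ0 hfin hb hC
      hs hδ hsF (abs_nonneg _) (le_abs_self _) hη0 hθ0 hlt.le hR hn (ε := ε) ?_ ?_ ν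
    · have h1 : 2 * η * (C - M - b + 1) ≤ 2 * η * (D + 1) := by
        gcongr
        exact le_abs_self _
      have h2 : 2 * η * (D + 1) = ε / 3 := by rw [hη]; field_simp; norm_num
      linarith
    · have h1 : ε * (D / δ * s.card + 1) = M' - M := div_mul_cancel₀ _ (by positivity)
      nlinarith
  calc _ ≤ (((n : ℝ)⁻¹ : ℝ) : EReal) * ((n * M' : ℝ) : EReal) :=
        mul_le_mul_of_nonneg_left hle (by exact_mod_cast (inv_pos.2 hn').le)
    _ = M' := by rw [← EReal.coe_mul, inv_mul_cancel_left₀ hn'.ne']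

end UpperBound

/-- **Theorem 3.1** (extended Sanov-type theorem, lower and upper bounds, for the `ψ`-weak
topology and semicontinuous unbounded `F`). -/
theorem sanov_extended
    {E : Type*} [MeasurableSpace E] [TopologicalSpace E] [PolishSpace E] [BorelSpace E]
    [Nonempty E]
    (α : ProbabilityMeasure E → EReal)
    (hproper : ∃ ν, α ν ≠ ⊤) (hbot : ∀ ν, α ν ≠ ⊥)
    (hconvex : ∀ (μ₁ μ₂ : ProbabilityMeasure E) (t : ℝ≥0), t ≤ 1 →
      extend α ((t : ℝ≥0∞) • (μ₁ : Measure E) + ((1 - t : ℝ≥0) : ℝ≥0∞) • (μ₂ : Measure E))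
        ≤ ((t : ℝ) : EReal) * α μ₁ + (((1 - t : ℝ≥0) : ℝ) : EReal) * α μ₂)
    (hcompact : ∀ c : ℝ, IsCompact {ν : ProbabilityMeasure E | α ν ≤ (c : EReal)})
    (ψ : E → ℝ) (hψc : Continuous ψ) (hψ0 : ∀ x, 0 ≤ ψ x) :
    -- lower bound: `F` lower semicontinuous and bounded from below
    (∀ F : Pw E ψ → EReal, LowerSemicontinuous F → (∃ C : ℝ, ∀ ν, (C : EReal) ≤ F ν) →
      (⨆ ν : Pw E ψ, F ν - α ν.toProb) ≤
        Filter.liminf (fun n : ℕ => (((n : ℝ)⁻¹ : ℝ) : EReal) *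
          rhon α n fun x => ((n : ℝ) : EReal) * liftPw ψ F (empirical n x)) Filter.atTop) ∧
    -- upper bound: sub-level sets of `α` pre-compact in `P_ψ(E)`, `F` upper semicontinuous
    -- and bounded from above
    ((∀ c : ℝ, (∀ ν : ProbabilityMeasure E, α ν ≤ (c : EReal) →
          ∫⁻ x, ENNReal.ofReal (ψ x) ∂(ν : Measure E) ≠ ⊤) ∧
        IsCompact (closure {ν : Pw E (ψ) | α ν.toProb ≤ (c : EReal)})) →
      ∀ F : Pw E ψ → EReal, UpperSemicontinuous F → (∃ C : ℝ, ∀ ν, F ν ≤ (C : EReal)) →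
      Filter.limsup (fun n : ℕ => (((n : ℝ)⁻¹ : ℝ) : EReal) *
          rhon α n fun x => ((n : ℝ) : EReal) * liftPw ψ F (empirical n x)) Filter.atTop ≤
        ⨆ ν : Pw E ψ, F ν - α ν.toProb) := by
  refine ⟨fun F hF ⟨C, hC⟩ => iSup_sub_le_liminf_rhon α hbot hψc hψ0 hF hC,
    fun h F hF ⟨C, hC⟩ => limsup_rhon_le_iSup_sub hproper hbot hconvex hcompact hψc hψ0
      (fun c => (h c).1) (fun c => isCompact_sublevel_Pw hψ0 hcompact (h c).2) hF hC⟩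

end SanovDual
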